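/- (Douglas–Rudin) Let f ∈ L^∞(𝕋) with ‖f‖_∞ ≤ 1, and let ε > 0. Then there exist inner functions ω_{i1}, ω_{i2} for 1 ≤ i ≤ n (which may be taken to be Blaschke products) and nonnegative reals λ₁, …, λ_n with λ₁ + ⋯ + λ_n = 1, such that ess sup_θ |λ₁ω_{11}(e^{iθ})/ω_{12}(e^{iθ}) + ⋯ + λ_nω_{n1}(e^{iθ})/ω_{n2}(e^{iθ}) − f(e^{iθ})| < ε. Consequently, the closed convex hull of quotients of inner functions equals the closed unit ball of L^∞(𝕋). -/

import Mathlib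

open Complex Metric Set Filter MeasureTheory
open scoped Topology Real

/-- A (possibly infinite) Blaschke product
`c z^m ∏ᵢ (|aᵢ|/aᵢ)·(aᵢ - z)/(1 - conj aᵢ · z)`. -/
noncomputable def blaschkeProd (m : ℕ) (c : ℂ) {ι : Type} (a : ι → ℂ) : ℂ → ℂ :=
  fun z => c * z ^ m *
    ∏' i, ((‖a i‖ : ℂ) / a i) * ((a i - z) / (1 - (starRingEnd ℂ) (a i) * z))

/-- `f` is a Blaschke product on the set `s`: it agrees there with
`c z^m ∏ᵢ (|aᵢ|/aᵢ)(aᵢ - z)/(1 - conj aᵢ z)` where `|c| = 1`, the `aᵢ` form a (finite or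
countable) family of nonzero points of the open unit disc satisfying the Blaschke condition
`∑ᵢ (1 - |aᵢ|) < ∞`. -/
def IsBlaschkeProductOn (f : ℂ → ℂ) (s : Set ℂ) : Prop :=
  ∃ (m : ℕ) (c : ℂ) (ι : Type) (_ : Countable ι) (a : ι → ℂ),
    ‖c‖ = 1 ∧ (∀ i, a i ≠ 0 ∧ ‖a i‖ < 1) ∧
    Summable (fun i => 1 - ‖a i‖) ∧
    Set.EqOn f (blaschkeProd m c a) s

/-- `φ` is an inner function: a bounded holomorphic function on the open unit disc whose radial
boundary values have modulus one almost everywhere. -/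
def IsInner (φ : ℂ → ℂ) : Prop :=
  DifferentiableOn ℂ φ (ball (0:ℂ) 1) ∧
  (∃ C : ℝ, ∀ z ∈ ball (0:ℂ) 1, ‖φ z‖ ≤ C) ∧
  ∀ᵐ (θ : ℝ) ∂(volume.restrict (Set.Ioc (0:ℝ) (2*π))),
    ∃ L : ℂ, ‖L‖ = 1 ∧
      Tendsto (fun r : ℝ => φ ((r : ℂ) * Complex.exp ((θ : ℂ) * Complex.I)))
        (𝓝[<] (1:ℝ)) (𝓝 L)

/-- The Poisson kernel of the unit disc, as a function of the radius and the angle. -/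
noncomputable def discKernel (r y : ℝ) : ℝ := (1 - r ^ 2) / (1 - 2 * r * Real.cos y + r ^ 2)

/-- The Poisson integral at `r * exp (θ * I)` of a function on `(0, 2π]`. -/
noncomputable def poissonIntegral {E : Type*} [NormedAddCommGroup E] [NormedSpace ℝ E]
    (ψ : ℝ → E) (r θ : ℝ) : E :=
  (2 * π)⁻¹ • ∫ t in (0:ℝ)..(2 * π), discKernel r (θ - t) • ψ t

section Kernel

variable {r : ℝ}

lemma discKernel_denom_pos (h1 : |r| < 1) (y : ℝ) :
    0 < 1 - 2 * r * Real.cos y + r ^ 2 := by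
  have h : r * Real.cos y ≤ |r| := by
    refine (le_abs_self _).trans ?_
    rw [abs_mul]
    exact mul_le_of_le_one_right (abs_nonneg r) (Real.abs_cos_le_one y)
  nlinarith [sq_abs r, mul_pos (sub_pos.2 h1) (sub_pos.2 h1)]

lemma discKernel_nonneg (h1 : |r| < 1) (y : ℝ) : 0 ≤ discKernel r y := by
  have := discKernel_denom_pos h1 y
  have : r ^ 2 < 1 := (sq_lt_one_iff_abs_lt_one r).2 h1
  unfold discKernel
  exact div_nonneg (by linarith) (by linarith)

lemma continuous_discKernel (h1 : |r| < 1) : Continuous (discKernel r) := by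
  unfold discKernel
  exact Continuous.div (by fun_prop) (by fun_prop) fun y => (discKernel_denom_pos h1 y).ne'

lemma discKernel_le_of_cos_le (h0 : 0 < r) (h1 : r < 1) {y c : ℝ} (hc : c < 1)
    (hy : Real.cos y ≤ c) : discKernel r y ≤ (1 - r ^ 2) / (2 * r * (1 - c)) := by
  unfold discKernel
  apply div_le_div_of_nonneg_left
  · nlinarith
  · have : 0 < 1 - c := by linarith
    positivity
  · nlinarith [mul_le_mul_of_nonneg_left hy h0.le, sq_nonneg (1 - r)]

lemma discKernel_le_of_abs_le_pi (h0 : 1 / 2 ≤ r) (h1 : r < 1) {y : ℝ} (hy : |y| ≤ π) :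
    discKernel r y ≤ 10 * ((1 - r) / ((1 - r) ^ 2 + y ^ 2)) := by
  have hc := Real.cos_le_one_sub_mul_cos_sq hy
  have hpi : π ^ 2 < 10 := by nlinarith [Real.pi_lt_d2, Real.pi_gt_three]
  have hh : 0 < (1 - r) ^ 2 := by have : 0 < 1 - r := by linarith
                                  positivity
  have hk : 1 / 5 ≤ 2 / π ^ 2 := by
    rw [div_le_div_iff₀ (by norm_num) (by positivity)]; linarith
  have hc' : Real.cos y ≤ 1 - 1 / 5 * y ^ 2 := by nlinarith [sq_nonneg y]
  have hD := discKernel_denom_pos (abs_lt.2 ⟨by linarith, h1⟩ : |r| < 1) y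
  have hY : 0 < (1 - r) ^ 2 + y ^ 2 := by positivity
  unfold discKernel
  rw [← mul_div_assoc, div_le_div_iff₀ hD hY]
  have e1 : (1 - r) ^ 2 + 1 / 5 * y ^ 2 ≤ 1 - 2 * r * Real.cos y + r ^ 2 := by
    nlinarith [mul_le_mul_of_nonneg_left hc' (by linarith : 0 ≤ 2 * r), sq_nonneg y]
  have e2 : 1 - r ^ 2 ≤ 2 * (1 - r) := by nlinarith
  calc (1 - r ^ 2) * ((1 - r) ^ 2 + y ^ 2)
      ≤ (2 * (1 - r)) * ((1 - r) ^ 2 + y ^ 2) := by gcongr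
    _ ≤ 10 * (1 - r) * ((1 - r) ^ 2 + 1 / 5 * y ^ 2) := by nlinarith
    _ ≤ _ := by
      apply mul_le_mul_of_nonneg_left e1; linarith

lemma norm_exp_sub_sq (r y : ℝ) :
    ‖Complex.exp (y * I) - r‖ ^ 2 = 1 - 2 * r * Real.cos y + r ^ 2 := by
  rw [← Complex.normSq_eq_norm_sq, Complex.normSq_apply]
  simp only [sub_re, sub_im, exp_ofReal_mul_I_re, exp_ofReal_mul_I_im, ofReal_re, ofReal_im]
  nlinarith [Real.sin_sq_add_cos_sq y]

lemma discKernel_eq (r y : ℝ) :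
    discKernel r y = (1 - r ^ 2) / ‖Complex.exp (y * I) - r‖ ^ 2 := by
  rw [norm_exp_sub_sq, discKernel]

lemma norm_exp_sub_exp_le (x y : ℝ) :
    ‖Complex.exp (x * I) - Complex.exp (y * I)‖ ≤ |x - y| := by
  have h : Complex.exp (x * I) - Complex.exp (y * I)
      = Complex.exp (y * I) * (Complex.exp (I * ((x - y : ℝ) : ℂ)) - 1) := by
    rw [mul_sub, ← Complex.exp_add]
    congr 1
    · congr 1; push_cast; ring
    · ring
  rw [h, norm_mul, Complex.norm_exp_ofReal_mul_I, one_mul]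
  exact (Real.norm_exp_I_mul_ofReal_sub_one_le (x := x - y)).trans_eq (Real.norm_eq_abs _)

/-- The kernel has bounded relative oscillation at scale `1 - r`. -/
lemma abs_discKernel_sub_le (h0 : 0 ≤ r) (h1 : r < 1) {κ y y' : ℝ} (hκ0 : 0 ≤ κ) (hκ : κ ≤ 1)
    (hy : |y - y'| ≤ κ * (1 - r)) :
    |discKernel r y - discKernel r y'| ≤ 3 * κ * discKernel r y' := by
  set D := ‖Complex.exp (y * I) - r‖ with hD
  set D' := ‖Complex.exp (y' * I) - r‖ with hD'
  have low : ∀ x : ℝ, 1 - r ≤ ‖Complex.exp (x * I) - r‖ := fun x => by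
    have := norm_sub_norm_le (Complex.exp (x * I)) (r : ℂ)
    rwa [Complex.norm_exp_ofReal_mul_I, Complex.norm_real, Real.norm_of_nonneg h0] at this
  have l1 : 1 - r ≤ D := low y
  have l2 : 1 - r ≤ D' := low y'
  have h1' : 0 < 1 - r := by linarith
  have hd : |D - D'| ≤ κ * (1 - r) := by
    refine (abs_norm_sub_norm_le _ _).trans ?_
    rw [sub_sub_sub_cancel_right]
    exact (norm_exp_sub_exp_le y y').trans hy
  rw [abs_le] at hd
  have hD0 : 0 < D := by linarith
  have hD0' : 0 < D' := by linarith
  have u1 : D ≤ (1 + κ) * D' := by nlinarith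
  have u2 : D' ≤ (1 + κ) * D := by nlinarith
  have hp : 0 < 1 - r ^ 2 := by nlinarith
  rw [discKernel_eq, discKernel_eq, ← hD, ← hD']
  have s1 : D ^ 2 ≤ (1 + 3 * κ) * D' ^ 2 := by
    calc D ^ 2 ≤ ((1 + κ) * D') ^ 2 := by gcongr
      _ = (1 + κ) ^ 2 * D' ^ 2 := by ring
      _ ≤ _ := by gcongr; nlinarith
  have s2 : D' ^ 2 ≤ (1 + 3 * κ) * D ^ 2 := by
    calc D' ^ 2 ≤ ((1 + κ) * D) ^ 2 := by gcongr
      _ = (1 + κ) ^ 2 * D ^ 2 := by ring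
      _ ≤ _ := by gcongr; nlinarith
  have e : (1 - r ^ 2) / D ^ 2 - (1 - r ^ 2) / D' ^ 2
      = (1 - r ^ 2) / D' ^ 2 * ((D' ^ 2 - D ^ 2) / D ^ 2) := by
    field_simp
  have hq : 0 < (1 - r ^ 2) / D' ^ 2 := by positivity
  rw [e, abs_mul, abs_of_pos hq, mul_comm]
  gcongr
  rw [abs_le, le_div_iff₀ (by positivity), div_le_iff₀ (by positivity)]
  constructor
  · by_cases hk : 3 * κ ≤ 1
    · nlinarith [sq_nonneg D, sq_nonneg D']
    · nlinarith [sq_nonneg D, sq_nonneg D']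
  · linarith

end Kernel

section PoissonFormula

/-- The Poisson formula for functions holomorphic in the disc and continuous up to its boundary. -/
lemma DiffContOnCl.poissonIntegral_eq {f : ℂ → ℂ} (hf : DiffContOnCl ℂ f (ball 0 1)) {r : ℝ}
    (h0 : 0 ≤ r) (h1 : r < 1) (θ : ℝ) :
    poissonIntegral (fun t => f (Complex.exp (t * I))) r θ = f (r * Complex.exp (θ * I)) := by
  have hw : (r * Complex.exp (θ * I) : ℂ) ∈ ball (0:ℂ) 1 := by
    simp [Complex.norm_exp_ofReal_mul_I, abs_of_nonneg h0, h1]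
  rw [← hf.circleAverage_poissonKernel_smul hw, Real.circleAverage_def, poissonIntegral]
  congr 1
  refine intervalIntegral.integral_congr fun t _ => ?_
  simp only [circleMap_zero, Pi.smul_apply', ofReal_one, one_mul]
  congr 1
  rw [poissonKernel_def, discKernel_eq]
  simp only [sub_zero, norm_mul, Complex.norm_exp_ofReal_mul_I, Complex.norm_real, mul_one,
    Real.norm_of_nonneg h0, one_pow]
  congr 2
  have : Complex.exp ((θ - t : ℝ) * I) - r
      = Complex.exp (-(t * I)) * (Complex.exp (θ * I) - r * Complex.exp (t * I)) := by
    rw [mul_sub, ← Complex.exp_add, mul_left_comm, ← Complex.exp_add]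
    simp only [neg_add_cancel, Complex.exp_zero, mul_one]
    congr 2; push_cast; ring
  have h2 : Complex.exp (-(t * I)) = Complex.exp ((-t : ℝ) * I) := by push_cast; ring_nf
  rw [this, norm_mul, h2, Complex.norm_exp_ofReal_mul_I, one_mul]
  rw [← Complex.norm_conj]
  have e1 : ∀ s : ℝ, (starRingEnd ℂ) (Complex.exp (s * I)) = (Complex.exp (s * I))⁻¹ := fun s => by
    rw [← Complex.exp_conj, ← Complex.exp_neg]; simp
  have e2 : (starRingEnd ℂ) (Complex.exp (θ * I) - r * Complex.exp (t * I))
     = Complex.exp ((-θ - t : ℝ) * I) * (Complex.exp (t * I) - r * Complex.exp (θ * I)) := by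
    rw [map_sub, map_mul, e1, e1, mul_sub, ← Complex.exp_neg, ← Complex.exp_neg, mul_left_comm,
      ← Complex.exp_add, ← Complex.exp_add, Complex.conj_ofReal]
    congr 3 <;> push_cast <;> ring
  rw [e2, norm_mul, Complex.norm_exp_ofReal_mul_I, one_mul]

lemma integral_discKernel {r : ℝ} (h0 : 0 ≤ r) (h1 : r < 1) (θ : ℝ) :
    ∫ t in (0:ℝ)..(2 * π), discKernel r (θ - t) = 2 * π := by
  have h := DiffContOnCl.poissonIntegral_eq (f := fun _ => 1)
    (differentiable_const (1:ℂ)).diffContOnCl h0 h1 θ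
  unfold poissonIntegral at h
  have e : ∫ t in (0:ℝ)..(2 * π), discKernel r (θ - t) • (1:ℂ)
      = ((∫ t in (0:ℝ)..(2 * π), discKernel r (θ - t) : ℝ) : ℂ) := by
    rw [← intervalIntegral.integral_ofReal]
    simp
  rw [e, Complex.real_smul, ← Complex.ofReal_mul, Complex.ofReal_eq_one] at h
  have := Real.pi_pos
  field_simp at h
  linarith

end PoissonFormula

section Fatou

/-- Dyadic decomposition of the Poisson kernel `h / (h² + y²)` near the origin. -/
lemma kernel_le_sum_indicator {h δ : ℝ} (hh : 0 < h) {J : ℕ} (hJ : δ ≤ 2 ^ J * h) {y : ℝ}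
    (hy : |y| ≤ δ) :
    h / (h ^ 2 + y ^ 2) ≤ ∑ j ∈ Finset.range (J + 1),
      if |y| ≤ 2 ^ j * h then 4 * (1 / 4) ^ j / h else 0 := by
  classical
  have hex : ∃ j : ℕ, |y| ≤ 2 ^ j * h := ⟨J, hy.trans hJ⟩
  have hj := Nat.find_spec hex
  have hjJ : Nat.find hex ≤ J := Nat.find_min' hex (hy.trans hJ)
  have hmin : ∀ m < Nat.find hex, ¬ |y| ≤ 2 ^ m * h := fun m => Nat.find_min hex
  generalize Nat.find hex = j at hj hjJ hmin
  have hs := Finset.single_le_sum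
    (f := fun j : ℕ => if |y| ≤ 2 ^ j * h then 4 * (1 / 4) ^ j / h else (0:ℝ))
    (fun i _ => by split_ifs <;> positivity)
    (Finset.mem_range.2 (Nat.lt_succ_of_le hjJ))
  refine le_trans ?_ hs
  simp only [hj, if_true]
  rw [div_le_div_iff₀ (by positivity) hh]
  rcases j with _ | j
  · simp; nlinarith [sq_nonneg y]
  · have h2 := not_le.1 (hmin j (Nat.lt_succ_self j))
    have h3 : (2 ^ j * h) ^ 2 ≤ y ^ 2 := by
      rw [← sq_abs y]; gcongr
    have h4 : (2:ℝ) ^ j * 2 ^ j * (1 / 4) ^ j = 1 := by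
      rw [← mul_pow, ← mul_pow]; norm_num
    have h5 : 0 < (1 / 4 : ℝ) ^ j := by positivity
    calc h * h = (1 / 4 : ℝ) ^ j * (2 ^ j * h) ^ 2 := by
          linear_combination (-h ^ 2) * h4
      _ ≤ (1 / 4 : ℝ) ^ j * (h ^ 2 + y ^ 2) := by gcongr; nlinarith [sq_nonneg h]
      _ = _ := by rw [pow_succ]; ring

lemma setIntegral_kernel_le {φ : ℝ → ℝ} (hφ : LocallyIntegrable φ) (hφ0 : ∀ t, 0 ≤ φ t)
    {θ h δ ε : ℝ} (hh : 0 < h) (hhδ : h ≤ δ) (hε : 0 ≤ ε)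
    (H : ∀ s, 0 < s → s ≤ 2 * δ → ∫ t in closedBall θ s, φ t ≤ ε * s) :
    ∫ t in closedBall θ δ, h / (h ^ 2 + (θ - t) ^ 2) * φ t ≤ 8 * ε := by
  obtain ⟨n, hn1, hn2⟩ := exists_nat_pow_near (x := δ / h) (y := (2:ℝ))
    ((one_le_div hh).2 hhδ) (by norm_num)
  rw [le_div_iff₀ hh] at hn1
  rw [div_lt_iff₀ hh] at hn2
  have hφball : ∀ s, IntegrableOn φ (closedBall θ s) := fun s =>
    hφ.integrableOn_isCompact (isCompact_closedBall θ s)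
  have hterm : ∀ j : ℕ, Integrable
      ((closedBall θ (2 ^ j * h)).indicator fun t => 4 * (1 / 4) ^ j / h * φ t) := fun j =>
    IntegrableOn.integrable_indicator ((hφball _).const_mul _) measurableSet_closedBall
  have hle : ∀ t ∈ closedBall θ δ, h / (h ^ 2 + (θ - t) ^ 2) * φ t
      ≤ ∑ j ∈ Finset.range (n + 1 + 1),
        (closedBall θ (2 ^ j * h)).indicator (fun t => 4 * (1 / 4) ^ j / h * φ t) t := by
    intro t ht
    classical
    have ht' : |θ - t| ≤ δ := by rw [abs_sub_comm]; exact ht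
    refine (mul_le_mul_of_nonneg_right (kernel_le_sum_indicator hh hn2.le ht') (hφ0 t)).trans_eq ?_
    rw [Finset.sum_mul]
    refine Finset.sum_congr rfl fun j _ => ?_
    rw [Set.indicator_apply]
    simp only [mem_closedBall, Real.dist_eq, abs_sub_comm t θ]
    split_ifs <;> simp
  calc ∫ t in closedBall θ δ, h / (h ^ 2 + (θ - t) ^ 2) * φ t
      ≤ ∫ t in closedBall θ δ, ∑ j ∈ Finset.range (n + 1 + 1),
        (closedBall θ (2 ^ j * h)).indicator (fun t => 4 * (1 / 4) ^ j / h * φ t) t := by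
        refine integral_mono_of_nonneg (ae_of_all _ fun t => ?_) ?_
          (ae_restrict_of_forall_mem measurableSet_closedBall hle)
        · have := hφ0 t
          positivity
        · exact (integrable_finsetSum _ fun j _ => hterm j).integrableOn
    _ ≤ ∫ t, ∑ j ∈ Finset.range (n + 1 + 1),
        (closedBall θ (2 ^ j * h)).indicator (fun t => 4 * (1 / 4) ^ j / h * φ t) t := by
        refine setIntegral_le_integral (integrable_finsetSum _ fun j _ => hterm j)
          (ae_of_all _ fun t => Finset.sum_nonneg fun j _ => Set.indicator_nonneg (fun t _ => ?_) t)
        have := hφ0 t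
        positivity
    _ = ∑ j ∈ Finset.range (n + 1 + 1), 4 * (1 / 4) ^ j / h *
          ∫ t in closedBall θ (2 ^ j * h), φ t := by
        rw [integral_finsetSum _ fun j _ => hterm j]
        refine Finset.sum_congr rfl fun j _ => ?_
        rw [integral_indicator measurableSet_closedBall, integral_const_mul]
    _ ≤ ∑ j ∈ Finset.range (n + 1 + 1), 4 * ε * (1 / 2) ^ j := by
        refine Finset.sum_le_sum fun j hj => ?_
        have h1 : (2:ℝ) ^ j * h ≤ 2 * δ := by
          have : (2:ℝ) ^ j ≤ 2 ^ (n + 1) :=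
            pow_le_pow_right₀ (by norm_num) (Nat.lt_succ_iff.1 (Finset.mem_range.1 hj))
          calc (2:ℝ) ^ j * h ≤ 2 ^ (n + 1) * h := by gcongr
            _ = 2 * (2 ^ n * h) := by ring
            _ ≤ _ := by gcongr
        have h2 : (1 / 4 : ℝ) ^ j * 2 ^ j = (1 / 2) ^ j := by rw [← mul_pow]; norm_num
        calc 4 * (1 / 4) ^ j / h * ∫ t in closedBall θ (2 ^ j * h), φ t
            ≤ 4 * (1 / 4) ^ j / h * (ε * (2 ^ j * h)) := by
              gcongr; exact H _ (by positivity) h1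
          _ = _ := by rw [← h2]; field_simp
    _ ≤ 8 * ε := by
        rw [← Finset.mul_sum]
        have := sum_geometric_two_le (n + 1 + 1)
        nlinarith

/-- **Fatou's theorem** for Poisson integrals. -/
theorem tendsto_poissonIntegral {E : Type*} [NormedAddCommGroup E] [NormedSpace ℝ E]
    [CompleteSpace E] {ψ : ℝ → E} (hψ : IntegrableOn ψ (Ioc 0 (2 * π))) :
    ∀ᵐ θ ∂(volume.restrict (Ioc (0:ℝ) (2 * π))),
      Tendsto (fun r => poissonIntegral ψ r θ) (𝓝[<] 1) (𝓝 (ψ θ)) := by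
  set Ψ : ℝ → E := (Ioc 0 (2 * π)).indicator ψ with hΨ
  have hΨi : Integrable Ψ := hψ.integrable_indicator measurableSet_Ioc
  have hne : ∀ᵐ θ : ℝ, θ ≠ 2 * π := by simp [ae_iff, measure_singleton]
  rw [ae_restrict_iff' measurableSet_Ioc]
  filter_upwards [IsUnifLocDoublingMeasure.ae_tendsto_average_norm_sub volume
    hΨi.locallyIntegrable 1, hne] with θ hL hθne hθ
  have hθ2 : θ < 2 * π := lt_of_le_of_ne hθ.2 hθne
  have hΨθ : Ψ θ = ψ θ := Set.indicator_of_mem hθ ψ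
  have hL' := hL (fun _ : ℝ => θ) (fun s => s) (l := 𝓝[>] 0) tendsto_id
    (by filter_upwards [self_mem_nhdsWithin] with s hs
        simpa using le_of_lt hs)
  set φ : ℝ → ℝ := fun t => ‖Ψ t - Ψ θ‖ with hφ
  have hφi : LocallyIntegrable φ :=
    fun x => ((hΨi.locallyIntegrable.sub (locallyIntegrable_const (Ψ θ))) x).norm
  have hφI : IntegrableOn φ (Ioc 0 (2 * π)) :=
    (hφi.integrableOn_isCompact isCompact_Icc).mono_set Ioc_subset_Icc_self
  have h2π := Real.two_pi_pos
  rw [Metric.tendsto_nhds]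
  intro e he
  obtain ⟨ε, hε, hεe⟩ : ∃ ε : ℝ, 0 < ε ∧ 80 * ε < e / 2 := ⟨e / 200, by linarith, by linarith⟩
  have hev := (hL'.eventually (gt_mem_nhds (half_pos hε)))
  rw [eventually_nhdsWithin_iff, Metric.eventually_nhds_iff] at hev
  obtain ⟨s₀, hs₀, hs⟩ := hev
  have hs' : ∀ s, 0 < s → s < s₀ → ∫ t in closedBall θ s, φ t ≤ ε * s := by
    intro s hs1 hs2
    have := hs (y := s) (by simpa [abs_of_pos hs1] using hs2) hs1
    rw [setAverage_eq, smul_eq_mul, Real.volume_real_closedBall hs1.le] at this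
    rw [inv_mul_lt_iff₀ (by positivity)] at this
    linarith
  obtain ⟨δ, hδ0, hδs, hδ1, hδ2, hδ3⟩ : ∃ δ : ℝ, 0 < δ ∧ 2 * δ < s₀ ∧ δ < θ ∧ δ < 2 * π - θ ∧
      δ < 1 := by
    have h4 : 0 < min (min (s₀ / 2) θ) (min (2 * π - θ) 1) := by
      have := hθ.1
      have : 0 < 2 * π - θ := by linarith
      positivity
    obtain ⟨δ, hδ0, hδ⟩ := exists_between h4
    simp only [lt_min_iff] at hδ
    exact ⟨δ, hδ0, by linarith [hδ.1.1], hδ.1.2, hδ.2.1, hδ.2.2⟩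
  have hπ3 := Real.pi_gt_three
  have hcosδ : Real.cos δ < 1 := by
    have := Real.cos_lt_cos_of_nonneg_of_le_pi (le_refl 0) (by linarith) hδ0
    simpa using this
  have hsub : closedBall θ δ ⊆ Ioc 0 (2 * π) := by
    intro t ht
    rw [Real.closedBall_eq_Icc] at ht
    exact ⟨by linarith [ht.1], by linarith [ht.2]⟩
  have hfar : ∀ t ∈ Ioc 0 (2 * π), t ∉ closedBall θ δ → Real.cos (θ - t) ≤ Real.cos δ := by
    intro t ht htn
    have h1 : δ < |θ - t| := by
      rw [abs_sub_comm]; simpa [Real.dist_eq] using htn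
    have h2 : |θ - t| ≤ 2 * π - δ := by
      rw [abs_le]; constructor <;> linarith [ht.1, ht.2]
    rw [← Real.cos_abs (θ - t)]
    by_cases h3 : |θ - t| ≤ π
    · exact Real.cos_le_cos_of_nonneg_of_le_pi hδ0.le h3 h1.le
    · rw [← Real.cos_two_pi_sub]
      exact Real.cos_le_cos_of_nonneg_of_le_pi hδ0.le (by linarith) (by linarith)
  set A := ∫ t in Ioc 0 (2 * π), φ t with hA
  have hκ : Tendsto (fun r : ℝ => (1 - r ^ 2) / (2 * r * (1 - Real.cos δ)) * A) (𝓝[<] 1) (𝓝 0) := by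
    have : ContinuousAt (fun r : ℝ => (1 - r ^ 2) / (2 * r * (1 - Real.cos δ)) * A) 1 := by
      refine ContinuousAt.mul (ContinuousAt.div (by fun_prop) (by fun_prop) ?_) continuousAt_const
      have : 1 - Real.cos δ ≠ 0 := by linarith
      simpa using this
    have h := this.tendsto
    simp only [one_pow, sub_self, zero_div, zero_mul] at h
    exact h.mono_left nhdsWithin_le_nhds
  have hr1 : ∀ᶠ r : ℝ in 𝓝[<] 1, r < 1 := self_mem_nhdsWithin
  have hr2 : ∀ᶠ r : ℝ in 𝓝[<] 1, 1 - δ / 2 < r :=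
    nhdsWithin_le_nhds (lt_mem_nhds (by linarith))
  filter_upwards [hr1, hr2, hκ.eventually (gt_mem_nhds (half_pos he))] with r hr1 hr2 hκr
  have hr0 : 1 / 2 ≤ r := by linarith
  have hrabs : |r| < 1 := abs_lt.2 ⟨by linarith, hr1⟩
  have hkc : Continuous fun t => discKernel r (θ - t) :=
    (continuous_discKernel hrabs).comp (by fun_prop)
  obtain ⟨κ, hκdef⟩ : ∃ κ, κ = (1 - r ^ 2) / (2 * r * (1 - Real.cos δ)) := ⟨_, rfl⟩
  rw [← hκdef] at hκr
  have hκ0 : 0 ≤ κ := by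
    rw [hκdef]
    apply div_nonneg <;> nlinarith
  have hψI : IntervalIntegrable ψ volume 0 (2 * π) :=
    (intervalIntegrable_iff_integrableOn_Ioc_of_le h2π.le).2 hψ
  have hK1 : IntervalIntegrable (fun t => discKernel r (θ - t) • ψ t) volume 0 (2 * π) :=
    hψI.continuousOn_smul hkc.continuousOn
  have hdiff : poissonIntegral ψ r θ - ψ θ
      = (2 * π)⁻¹ • ∫ t in (0:ℝ)..(2 * π), discKernel r (θ - t) • (ψ t - ψ θ) := by
    have : ψ θ = (2 * π)⁻¹ • ∫ t in (0:ℝ)..(2 * π), discKernel r (θ - t) • ψ θ := by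
      rw [intervalIntegral.integral_smul_const, integral_discKernel (by linarith) hr1, smul_smul,
        inv_mul_cancel₀ h2π.ne', one_smul]
    rw [poissonIntegral]
    conv_lhs => rw [this]
    have hK2 : IntervalIntegrable (fun t => discKernel r (θ - t) • ψ θ) volume 0 (2 * π) :=
      (hkc.smul continuous_const).intervalIntegrable _ _
    rw [← smul_sub, ← intervalIntegral.integral_sub hK1 hK2]
    simp only [smul_sub]
  set K : ℝ → ℝ := fun t => (1 - r) / ((1 - r) ^ 2 + (θ - t) ^ 2) * φ t with hK
  have hh : 0 < 1 - r := by linarith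
  have hKc : Continuous fun t => (1 - r) / ((1 - r) ^ 2 + (θ - t) ^ 2) :=
    Continuous.div (by fun_prop) (by fun_prop) fun t => by positivity
  have hKi : IntegrableOn K (closedBall θ δ) := by
    have := (hφi.integrableOn_isCompact (isCompact_closedBall θ δ)).continuousOn_mul
      hKc.continuousOn (isCompact_closedBall θ δ)
    exact this
  have hKi' : Integrable ((closedBall θ δ).indicator fun t => 10 * K t) :=
    IntegrableOn.integrable_indicator (hKi.const_mul 10) measurableSet_closedBall
  have hbound : ∫ t in Ioc 0 (2 * π), discKernel r (θ - t) * φ t ≤ κ * A + 80 * ε := by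
    calc ∫ t in Ioc 0 (2 * π), discKernel r (θ - t) * φ t
        ≤ ∫ t in Ioc 0 (2 * π), (κ * φ t + (closedBall θ δ).indicator (fun t => 10 * K t) t) := by
          refine integral_mono_of_nonneg (ae_of_all _ fun t =>
            mul_nonneg (discKernel_nonneg hrabs _) (norm_nonneg _))
            ((hφI.const_mul κ).add hKi'.integrableOn)
            (ae_restrict_of_forall_mem measurableSet_Ioc fun t ht => ?_)
          by_cases hb : t ∈ closedBall θ δ
          · simp only [Set.indicator_of_mem hb]
            have hy : |θ - t| ≤ π := by
              have : |θ - t| ≤ δ := by rw [abs_sub_comm]; exact hb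
              linarith
            have := mul_le_mul_of_nonneg_right (discKernel_le_of_abs_le_pi hr0 hr1 hy)
              (norm_nonneg (Ψ t - Ψ θ))
            have h3 : 0 ≤ κ * φ t := mul_nonneg hκ0 (norm_nonneg _)
            simp only [hK, hφ] at *
            linarith
          · simp only [Set.indicator_of_notMem hb, add_zero]
            have := discKernel_le_of_cos_le (by linarith) hr1 hcosδ (hfar t ht hb)
            rw [← hκdef] at this
            exact mul_le_mul_of_nonneg_right this (norm_nonneg _)
      _ = κ * A + 10 * ∫ t in closedBall θ δ, K t := by
          rw [integral_add (hφI.const_mul κ) hKi'.integrableOn, integral_const_mul,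
            setIntegral_indicator measurableSet_closedBall, inter_eq_right.2 hsub,
            integral_const_mul]
      _ ≤ κ * A + 80 * ε := by
          have := setIntegral_kernel_le hφi (fun t => norm_nonneg _) (θ := θ) hh
            (by linarith : 1 - r ≤ δ) hε.le fun s h1 h2 => hs' s h1 (by linarith)
          linarith
  rw [dist_eq_norm, hdiff, norm_smul, norm_inv, Real.norm_of_nonneg h2π.le]
  have h5 : ‖∫ t in (0:ℝ)..(2 * π), discKernel r (θ - t) • (ψ t - ψ θ)‖ ≤ κ * A + 80 * ε := by
    rw [intervalIntegral.integral_of_le h2π.le]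
    refine (norm_integral_le_integral_norm _).trans (le_trans (le_of_eq ?_) hbound)
    refine setIntegral_congr_fun measurableSet_Ioc fun t ht => ?_
    simp only [hφ, norm_smul, Real.norm_of_nonneg (discKernel_nonneg hrabs _), hΨθ]
    rw [hΨ, Set.indicator_of_mem ht]
  rw [inv_mul_lt_iff₀ h2π]
  nlinarith

end Fatou

section Factor

/-- A single normalised Blaschke factor. -/
noncomputable def blaschkeFactor (a z : ℂ) : ℂ :=
  ((‖a‖ : ℂ) / a) * ((a - z) / (1 - (starRingEnd ℂ) a * z))

lemma one_sub_conj_mul_ne_zero {a z : ℂ} (ha : ‖a‖ < 1) (hz : ‖z‖ ≤ 1) :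
    1 - (starRingEnd ℂ) a * z ≠ 0 := by
  intro h
  have h1 : (starRingEnd ℂ) a * z = 1 := (sub_eq_zero.1 h).symm
  have h2 : ‖a‖ * ‖z‖ = 1 := by
    rw [← Complex.norm_conj a, ← norm_mul, h1, norm_one]
  nlinarith [norm_nonneg a, norm_nonneg z]

lemma blaschkeFactor_zero {a : ℂ} (ha : a ≠ 0) : blaschkeFactor a 0 = ‖a‖ := by
  simp [blaschkeFactor, ha]

lemma normSq_one_sub_conj_mul (a z : ℂ) :
    ‖1 - (starRingEnd ℂ) a * z‖ ^ 2 - ‖a - z‖ ^ 2 = (1 - ‖a‖ ^ 2) * (1 - ‖z‖ ^ 2) := by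
  simp only [← Complex.normSq_eq_norm_sq, Complex.normSq_apply, sub_re, sub_im, mul_re, mul_im,
    conj_re, conj_im, one_re, one_im]
  ring

lemma norm_blaschkeFactor {a z : ℂ} (ha : a ≠ 0) :
    ‖blaschkeFactor a z‖ = ‖a - z‖ / ‖1 - (starRingEnd ℂ) a * z‖ := by
  have : ‖a‖ ≠ 0 := norm_ne_zero_iff.2 ha
  rw [blaschkeFactor, norm_mul, norm_div, norm_div, Complex.norm_real, norm_norm, div_self this,
    one_mul]

lemma norm_blaschkeFactor_le {a z : ℂ} (ha : a ≠ 0) (ha1 : ‖a‖ < 1) (hz : ‖z‖ ≤ 1) :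
    ‖blaschkeFactor a z‖ ≤ 1 := by
  rw [norm_blaschkeFactor ha,
    div_le_one (norm_pos_iff.2 (one_sub_conj_mul_ne_zero ha1 hz))]
  have h := normSq_one_sub_conj_mul a z
  have h1 : 0 ≤ (1 - ‖a‖ ^ 2) * (1 - ‖z‖ ^ 2) := by
    apply mul_nonneg <;> nlinarith [norm_nonneg a, norm_nonneg z]
  exact le_of_sq_le_sq (by linarith) (norm_nonneg _)

lemma norm_blaschkeFactor_eq_one {a z : ℂ} (ha : a ≠ 0) (ha1 : ‖a‖ < 1) (hz : ‖z‖ = 1) :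
    ‖blaschkeFactor a z‖ = 1 := by
  have h0 := norm_pos_iff.2 (one_sub_conj_mul_ne_zero ha1 hz.le)
  rw [norm_blaschkeFactor ha, div_eq_one_iff_eq h0.ne']
  have h := normSq_one_sub_conj_mul a z
  rw [hz] at h
  exact (sq_eq_sq₀ (norm_nonneg _) h0.le).1 (by linarith)

lemma norm_blaschkeFactor_sub_one_le {a z : ℂ} (ha : a ≠ 0) (ha1 : ‖a‖ < 1) (hz : ‖z‖ < 1) :
    ‖blaschkeFactor a z - 1‖ ≤ 2 / (1 - ‖z‖) * (1 - ‖a‖) := by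
  have hne := one_sub_conj_mul_ne_zero ha1 hz.le
  have haa : (starRingEnd ℂ) a * a = (‖a‖ : ℂ) ^ 2 := Complex.conj_mul' a
  have e : blaschkeFactor a z - 1
      = -((1 - ‖a‖ : ℝ) : ℂ) * (a + ‖a‖ * z) / (a * (1 - (starRingEnd ℂ) a * z)) := by
    rw [blaschkeFactor, div_mul_div_comm, div_sub_one (mul_ne_zero ha hne)]
    congr 1
    push_cast
    linear_combination z * haa
  have hna : 0 < ‖a‖ := norm_pos_iff.2 ha
  have h1 : ‖a + ‖a‖ * z‖ ≤ 2 * ‖a‖ := by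
    refine (norm_add_le _ _).trans ?_
    rw [norm_mul, Complex.norm_real, norm_norm]
    nlinarith
  have h2 : 1 - ‖z‖ ≤ ‖1 - (starRingEnd ℂ) a * z‖ := by
    have := norm_sub_norm_le 1 ((starRingEnd ℂ) a * z)
    rw [norm_one, norm_mul, Complex.norm_conj] at this
    nlinarith [norm_nonneg z]
  have h3 : 0 < 1 - ‖z‖ := by linarith
  have h4 : 0 ≤ 1 - ‖a‖ := by linarith
  rw [e, norm_div, norm_mul, norm_neg, norm_mul, Complex.norm_real, Real.norm_of_nonneg h4]
  calc (1 - ‖a‖) * ‖a + ‖a‖ * z‖ / (‖a‖ * ‖1 - (starRingEnd ℂ) a * z‖)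
      ≤ (1 - ‖a‖) * (2 * ‖a‖) / (‖a‖ * (1 - ‖z‖)) := by gcongr
    _ = _ := by field_simp

lemma differentiableAt_blaschkeFactor {a z : ℂ} (ha1 : ‖a‖ < 1) (hz : ‖z‖ ≤ 1) :
    DifferentiableAt ℂ (blaschkeFactor a) z := by
  unfold blaschkeFactor
  exact (differentiableAt_const _).mul (DifferentiableAt.div (by fun_prop) (by fun_prop)
    (one_sub_conj_mul_ne_zero ha1 hz))

end Factor

section Products

lemma norm_prod_le_one {ι : Type*} (s : Finset ι) {u : ι → ℂ} (hu : ∀ i ∈ s, ‖u i‖ ≤ 1) :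
    ‖∏ i ∈ s, u i‖ ≤ 1 := by
  rw [norm_prod]
  exact Finset.prod_le_one (fun _ _ => norm_nonneg _) hu

lemma norm_prod_sub_prod_le {ι : Type*} (s : Finset ι) {u v : ι → ℂ} (hu : ∀ i ∈ s, ‖u i‖ ≤ 1)
    (hv : ∀ i ∈ s, ‖v i‖ ≤ 1) :
    ‖∏ i ∈ s, u i - ∏ i ∈ s, v i‖ ≤ ∑ i ∈ s, ‖u i - v i‖ := by
  classical
  induction s using Finset.induction_on with
  | empty => simp
  | insert i s hi ih =>
    rw [Finset.prod_insert hi, Finset.prod_insert hi, Finset.sum_insert hi]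
    have hu' : ∀ j ∈ s, ‖u j‖ ≤ 1 := fun j hj => hu j (Finset.mem_insert_of_mem hj)
    have hv' : ∀ j ∈ s, ‖v j‖ ≤ 1 := fun j hj => hv j (Finset.mem_insert_of_mem hj)
    have e : u i * ∏ j ∈ s, u j - v i * ∏ j ∈ s, v j
        = (u i - v i) * ∏ j ∈ s, u j + v i * (∏ j ∈ s, u j - ∏ j ∈ s, v j) := by ring
    rw [e]
    refine (norm_add_le _ _).trans (add_le_add ?_ ?_)
    · rw [norm_mul]
      exact mul_le_of_le_one_right (norm_nonneg _) (norm_prod_le_one s hu')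
    · rw [norm_mul]
      exact (mul_le_of_le_one_left (norm_nonneg _) (hv i (Finset.mem_insert_self i s))).trans
        (ih hu' hv')

lemma ae_summable_of_summable_integral {α : Type*} [MeasurableSpace α] {μ : Measure α}
    {F : ℕ → α → ℝ} (h0 : ∀ k x, 0 ≤ F k x) (hi : ∀ k, Integrable (F k) μ)
    (hs : Summable fun k => ∫ x, F k x ∂μ) : ∀ᵐ x ∂μ, Summable fun k => F k x := by
  have hm : ∀ k, AEMeasurable (fun x => ENNReal.ofReal (F k x)) μ := fun k =>
    (hi k).aemeasurable.ennreal_ofReal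
  have h1 : ∫⁻ x, ∑' k, ENNReal.ofReal (F k x) ∂μ ≠ ⊤ := by
    rw [lintegral_tsum hm]
    simp_rw [← ofReal_integral_eq_lintegral_ofReal (hi _) (ae_of_all _ (h0 _))]
    exact hs.tsum_ofReal_ne_top
  filter_upwards [ae_lt_top' (AEMeasurable.tsum hm) h1] with x hx
  have := ENNReal.summable_toReal hx.ne
  simpa only [ENNReal.toReal_ofReal (h0 _ x)] using this

end Products

section BlaschkeBoundary

lemma differentiableAt_prod_blaschkeFactor {ι : Type*} (T : Finset ι) {c : ι → ℂ}
    (h1 : ∀ n, ‖c n‖ < 1) {z : ℂ} (hz : ‖z‖ ≤ 1) :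
    DifferentiableAt ℂ (fun z => ∏ n ∈ T, blaschkeFactor (c n) z) z := by
  classical
  induction T using Finset.induction_on with
  | empty => simp
  | insert i s hi ih =>
    simp only [Finset.prod_insert hi]
    exact (differentiableAt_blaschkeFactor (h1 i) hz).mul ih

lemma diffContOnCl_prod_blaschkeFactor {ι : Type*} (T : Finset ι) {c : ι → ℂ}
    (h1 : ∀ n, ‖c n‖ < 1) :
    DiffContOnCl ℂ (fun z => ∏ n ∈ T, blaschkeFactor (c n) z) (ball 0 1) := by
  apply DifferentiableOn.diffContOnCl
  rw [closure_ball _ one_ne_zero]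
  intro z hz
  exact (differentiableAt_prod_blaschkeFactor T h1
    (by simpa using hz)).differentiableWithinAt

lemma continuous_prod_blaschkeFactor {ι : Type*} (T : Finset ι) {c : ι → ℂ}
    (h1 : ∀ n, ‖c n‖ < 1) :
    Continuous fun t : ℝ => ∏ n ∈ T, blaschkeFactor (c n) (Complex.exp (t * I)) := by
  rw [continuous_iff_continuousAt]
  intro t
  have h := (differentiableAt_prod_blaschkeFactor T h1
    (Complex.norm_exp_ofReal_mul_I t).le).continuousAt
  have h2 : ContinuousAt (fun t : ℝ => Complex.exp (t * I)) t := by fun_prop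
  exact ContinuousAt.comp (f := fun t : ℝ => Complex.exp (t * I)) h h2

/-- A finite Blaschke product is mean-square close to `1` on the circle when its zeros are close to
the circle. -/
lemma integral_norm_prod_blaschkeFactor_sub_one_sq_le {ι : Type*} (T : Finset ι) {c : ι → ℂ}
    (h0 : ∀ n, c n ≠ 0) (h1 : ∀ n, ‖c n‖ < 1) :
    ∫ t in Ioc 0 (2 * π), ‖∏ n ∈ T, blaschkeFactor (c n) (Complex.exp (t * I)) - 1‖ ^ 2
      ≤ 4 * π * ∑ n ∈ T, (1 - ‖c n‖) := by
  set q : ℝ → ℂ := fun t => ∏ n ∈ T, blaschkeFactor (c n) (Complex.exp (t * I)) with hq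
  have hqc : Continuous q := continuous_prod_blaschkeFactor T h1
  have hq1 : ∀ t, ‖q t‖ = 1 := fun t => by
    rw [hq, norm_prod]
    exact Finset.prod_eq_one fun n _ =>
      norm_blaschkeFactor_eq_one (h0 n) (h1 n) (Complex.norm_exp_ofReal_mul_I t)
  have hsq : ∀ t, ‖q t - 1‖ ^ 2 = 2 - 2 * (q t).re := fun t => by
    have := hq1 t
    have h3 : ‖q t‖ ^ 2 = 1 := by rw [this]; norm_num
    rw [← Complex.normSq_eq_norm_sq, Complex.normSq_apply] at h3 ⊢
    simp only [sub_re, sub_im, one_re, one_im]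
    linarith
  have h2π := Real.two_pi_pos
  have hmean := (diffContOnCl_prod_blaschkeFactor T h1).poissonIntegral_eq (le_refl 0) one_pos 0
  simp only [poissonIntegral, discKernel, Complex.ofReal_zero, zero_mul, mul_zero, sub_zero,
    blaschkeFactor_zero (h0 _)] at hmean
  norm_num at hmean
  rw [intervalIntegral.integral_of_le h2π.le] at hmean
  have hqi : IntegrableOn q (Ioc 0 (2 * π)) := (hqc.integrableOn_Icc).mono_set Ioc_subset_Icc_self
  have hI : ∫ t in Ioc 0 (2 * π), (q t).re = 2 * π * ∏ n ∈ T, ‖c n‖ := by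
    have h5 : ∫ t in Ioc 0 (2 * π), q t = 2 * π * ∏ n ∈ T, (‖c n‖ : ℂ) := by
      rw [← hmean]
      have : (π : ℂ) ≠ 0 := by exact_mod_cast Real.pi_ne_zero
      field_simp
      rfl
    have h6 := reCLM.integral_comp_comm hqi
    simp only [reCLM_apply] at h6
    rw [h6, h5]
    have : (2 * π * ∏ n ∈ T, (‖c n‖ : ℂ)) = ((2 * π * ∏ n ∈ T, ‖c n‖ : ℝ) : ℂ) := by push_cast; rfl
    rw [this, Complex.ofReal_re]
  have hre : IntegrableOn (fun t => 2 * (q t).re) (Ioc 0 (2 * π)) :=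
    (reCLM.integrable_comp hqi).const_mul 2
  rw [integral_congr_ae (ae_of_all _ hsq), integral_sub (by simp) hre, integral_const_mul, hI]
  simp only [integral_const, measureReal_restrict_apply_univ, Real.volume_real_Ioc_of_le h2π.le,
    smul_eq_mul]
  have hp : 1 - ∏ n ∈ T, ‖c n‖ ≤ ∑ n ∈ T, (1 - ‖c n‖) := by
    have h := norm_prod_sub_prod_le T (u := fun _ => 1) (v := fun n => (‖c n‖ : ℂ))
      (fun _ _ => by simp) (fun n _ => by simpa using (h1 n).le)
    have e : ∏ _n ∈ T, (1:ℂ) - ∏ n ∈ T, (‖c n‖ : ℂ) = ((1 - ∏ n ∈ T, ‖c n‖ : ℝ) : ℂ) := by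
      push_cast; simp
    rw [e, Complex.norm_real] at h
    refine (le_abs_self _).trans (h.trans_eq (Finset.sum_congr rfl fun n _ => ?_))
    rw [← Complex.ofReal_one, ← Complex.ofReal_sub, Complex.norm_real,
      Real.norm_of_nonneg (by linarith [h1 n])]
  nlinarith [Real.pi_pos]

end BlaschkeBoundary

section InfiniteProduct

lemma blaschkeProd_zero_one_apply {ι : Type} (A : ι → ℂ) (z : ℂ) :
    blaschkeProd 0 1 A z = ∏' i, blaschkeFactor (A i) z := by
  simp [blaschkeProd, blaschkeFactor]

variable {ι : Type} {A : ι → ℂ}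

lemma hasProdLocallyUniformlyOn_blaschkeFactor (h0 : ∀ i, A i ≠ 0) (h1 : ∀ i, ‖A i‖ < 1)
    (hs : Summable fun i => 1 - ‖A i‖) {R : ℝ} (hR : R < 1) :
    HasProdLocallyUniformlyOn (fun i => blaschkeFactor (A i)) (blaschkeProd 0 1 A)
      (ball 0 R) := by
  have h := Summable.hasProdLocallyUniformlyOn_one_add (K := ball (0:ℂ) R)
    (f := fun i z => blaschkeFactor (A i) z - 1) isOpen_ball (hs.mul_left (2 / (1 - R)))
    (Eventually.of_forall fun i z hz => by
      have hz' : ‖z‖ < R := by simpa using hz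
      have h2 : 0 ≤ 1 - ‖A i‖ := by linarith [h1 i]
      have h3 : 0 < 1 - R := by linarith
      refine (norm_blaschkeFactor_sub_one_le (h0 i) (h1 i) (hz'.trans hR)).trans ?_
      gcongr)
    (fun i z hz => by
      have hz' : ‖z‖ < R := by simpa using hz
      exact ((differentiableAt_blaschkeFactor (h1 i)
        (hz'.trans hR).le).continuousAt.sub continuousAt_const).continuousWithinAt)
  have e : blaschkeProd 0 1 A = fun z => ∏' i, blaschkeFactor (A i) z :=
    funext (blaschkeProd_zero_one_apply A)
  simpa only [add_sub_cancel, e] using h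

lemma hasProd_blaschkeFactor (h0 : ∀ i, A i ≠ 0) (h1 : ∀ i, ‖A i‖ < 1)
    (hs : Summable fun i => 1 - ‖A i‖) {z : ℂ} (hz : ‖z‖ < 1) :
    HasProd (fun i => blaschkeFactor (A i) z) (blaschkeProd 0 1 A z) := by
  obtain ⟨R, hzR, hR⟩ := exists_between hz
  exact (hasProdLocallyUniformlyOn_blaschkeFactor h0 h1 hs hR).hasProd (by simpa using hzR)

lemma differentiableOn_blaschkeProd (h0 : ∀ i, A i ≠ 0) (h1 : ∀ i, ‖A i‖ < 1)
    (hs : Summable fun i => 1 - ‖A i‖) : DifferentiableOn ℂ (blaschkeProd 0 1 A) (ball 0 1) := by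
  intro z hz
  obtain ⟨R, hzR, hR⟩ := exists_between (show ‖z‖ < 1 by simpa using hz)
  have h : DifferentiableOn ℂ (blaschkeProd 0 1 A) (ball 0 R) :=
    (hasProdLocallyUniformlyOn_blaschkeFactor h0 h1 hs hR).differentiableOn
      (.of_forall fun T w hw => (differentiableAt_prod_blaschkeFactor T h1
        ((show ‖w‖ < R by simpa using hw).trans hR).le).differentiableWithinAt) isOpen_ball
  exact (h.differentiableAt (isOpen_ball.mem_nhds (by simpa using hzR))).differentiableWithinAt

lemma norm_blaschkeProd_le_one (h0 : ∀ i, A i ≠ 0) (h1 : ∀ i, ‖A i‖ < 1)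
    (hs : Summable fun i => 1 - ‖A i‖) {z : ℂ} (hz : ‖z‖ < 1) : ‖blaschkeProd 0 1 A z‖ ≤ 1 :=
  le_of_tendsto (hasProd_blaschkeFactor h0 h1 hs hz).norm (.of_forall fun _ =>
    Finset.prod_le_one (fun _ _ => norm_nonneg _) fun i _ =>
      norm_blaschkeFactor_le (h0 i) (h1 i) hz.le)

end InfiniteProduct

section BlockBoundary

variable {S : ℕ → Finset ℕ} {a : ℕ → ℕ → ℂ} {C : ℝ}

lemma ae_tendsto_prod_blaschkeFactor (h0 : ∀ k n, a k n ≠ 0) (h1 : ∀ k n, ‖a k n‖ < 1)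
    (hC : ∀ k, ∑ n ∈ S k, (1 - ‖a k n‖) ≤ C * (1 / 4) ^ k) :
    ∀ᵐ θ ∂(volume.restrict (Ioc 0 (2 * π))), ∃ L : ℂ,
      Tendsto (fun K => ∏ k ∈ Finset.range K, ∏ n ∈ S k,
        blaschkeFactor (a k n) (Complex.exp ((θ : ℝ) * I))) atTop (𝓝 L) := by
  set q : ℕ → ℝ → ℂ := fun k θ => ∏ n ∈ S k, blaschkeFactor (a k n) (Complex.exp (θ * I)) with hq
  have hqc : ∀ k, Continuous (q k) := fun k => continuous_prod_blaschkeFactor (S k) (h1 k)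
  have hq1 : ∀ k θ, ‖q k θ‖ ≤ 1 := fun k θ => norm_prod_le_one _ fun n _ =>
    norm_blaschkeFactor_le (h0 k n) (h1 k n) (Complex.norm_exp_ofReal_mul_I θ).le
  have hsum : Summable fun k => ∫ θ in Ioc 0 (2 * π), 2 ^ k * ‖q k θ - 1‖ ^ 2 := by
    refine Summable.of_nonneg_of_le (fun k => integral_nonneg fun θ => by positivity)
      (fun k => ?_) ((summable_geometric_of_lt_one (by norm_num : (0:ℝ) ≤ 1 / 2)
        (by norm_num)).mul_left (4 * π * C))
    rw [integral_const_mul]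
    calc 2 ^ k * ∫ θ in Ioc 0 (2 * π), ‖q k θ - 1‖ ^ 2
        ≤ 2 ^ k * (4 * π * (C * (1 / 4) ^ k)) := by
          gcongr
          refine (integral_norm_prod_blaschkeFactor_sub_one_sq_le (S k) (h0 k) (h1 k)).trans ?_
          have := hC k
          gcongr
      _ = 4 * π * C * (1 / 2) ^ k := by
          have : (1 / 2 : ℝ) ^ k = 2 ^ k * (1 / 4) ^ k := by rw [← mul_pow]; norm_num
          rw [this]; ring
  filter_upwards [ae_summable_of_summable_integral (fun k θ => by positivity)
    (fun k => ((by fun_prop : Continuous fun θ => 2 ^ k * ‖q k θ - 1‖ ^ 2).integrableOn_Icc).mono_set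
      Ioc_subset_Icc_self) hsum] with θ hθ
  refine cauchySeq_tendsto_of_complete (cauchySeq_of_dist_le_of_summable
    (fun k => 1 / 2 * (2 ^ k * ‖q k θ - 1‖ ^ 2 + (1 / 2) ^ k)) (fun K => ?_)
    ((hθ.add (summable_geometric_of_lt_one (by norm_num) (by norm_num))).mul_left _))
  have hp : ‖∏ k ∈ Finset.range K, q k θ‖ ≤ 1 := norm_prod_le_one _ fun k _ => hq1 k θ
  rw [dist_comm, dist_eq_norm, Finset.prod_range_succ]
  change ‖(∏ k ∈ Finset.range K, q k θ) * q K θ - ∏ k ∈ Finset.range K, q k θ‖ ≤ _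
  rw [← mul_sub_one, norm_mul]
  refine (mul_le_of_le_one_left (norm_nonneg _) hp).trans ?_
  have e : (1 / 2 : ℝ) ^ K * 2 ^ K = 1 := by rw [← mul_pow]; norm_num
  have hpos : (0:ℝ) < (1 / 2) ^ K := by positivity
  have h2 : (0:ℝ) < 2 ^ K := by positivity
  have : 0 ≤ (1 / 2 : ℝ) ^ K * (2 ^ K * ‖q K θ - 1‖ - 1) ^ 2 := by positivity
  linear_combination 1 / 2 * this
    + (1 / 2 * 2 ^ K * ‖q K θ - 1‖ ^ 2 - ‖q K θ - 1‖) * e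

/-- An infinite Blaschke product whose zeros come in rapidly decreasing blocks is inner, and its
boundary function is the almost everywhere limit of the partial products over the blocks. -/
lemma exists_isInner_of_blocks (h0 : ∀ k n, a k n ≠ 0) (h1 : ∀ k n, ‖a k n‖ < 1)
    (hC : ∀ k, ∑ n ∈ S k, (1 - ‖a k n‖) ≤ C * (1 / 4) ^ k) :
    ∃ (ω : ℂ → ℂ) (β : ℝ → ℂ), IsInner ω ∧ IsBlaschkeProductOn ω (ball 0 1) ∧
      ∀ᵐ θ ∂(volume.restrict (Ioc 0 (2 * π))), ‖β θ‖ = 1 ∧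
        Tendsto (fun r : ℝ => ω (r * Complex.exp (θ * I))) (𝓝[<] 1) (𝓝 (β θ)) ∧
        Tendsto (fun K => ∏ k ∈ Finset.range K, ∏ n ∈ S k,
          blaschkeFactor (a k n) (Complex.exp (θ * I))) atTop (𝓝 (β θ)) := by
  set A : (Σ k, S k) → ℂ := fun i => a i.1 i.2 with hA
  have hA0 : ∀ i, A i ≠ 0 := fun i => h0 _ _
  have hA1 : ∀ i, ‖A i‖ < 1 := fun i => h1 _ _
  have hs : Summable fun i => 1 - ‖A i‖ := by
    rw [summable_sigma_of_nonneg fun i => by linarith [hA1 i]]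
    refine ⟨fun k => Summable.of_finite, ?_⟩
    refine Summable.of_nonneg_of_le (fun k => tsum_nonneg fun i => by linarith [hA1 ⟨k, i⟩])
      (fun k => ?_) ((summable_geometric_of_lt_one (by norm_num : (0:ℝ) ≤ 1 / 4)
        (by norm_num)).mul_left C)
    rw [tsum_fintype]
    refine le_trans (le_of_eq ?_) (hC k)
    exact Finset.sum_coe_sort (S k) fun n => 1 - ‖a k n‖
  set P : ℕ → ℂ → ℂ := fun K z => ∏ k ∈ Finset.range K, ∏ n ∈ S k, blaschkeFactor (a k n) z with hP
  set T : ℕ → Finset (Σ k, S k) := fun K => (Finset.range K).sigma fun _ => Finset.univ with hT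
  have hPT : ∀ K z, P K z = ∏ i ∈ T K, blaschkeFactor (A i) z := fun K z => by
    rw [hP, hT, Finset.prod_sigma]
    refine Finset.prod_congr rfl fun k _ => ?_
    exact (Finset.prod_coe_sort (S k) fun n => blaschkeFactor (a k n) z).symm
  have hTt : Tendsto T atTop atTop := by
    refine tendsto_atTop_finset_of_monotone (fun K L hKL => ?_) fun i => ⟨i.1 + 1, by simp [hT]⟩
    exact Finset.sigma_mono (Finset.range_mono hKL) fun _ => subset_rfl
  have hlim : ∀ z : ℂ, ‖z‖ < 1 → Tendsto (fun K => P K z) atTop (𝓝 (blaschkeProd 0 1 A z)) :=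
    fun z hz => by
      have := (hasProd_blaschkeFactor hA0 hA1 hs hz).comp hTt
      exact this.congr fun K => (hPT K z).symm
  have hPd : ∀ K, DiffContOnCl ℂ (P K) (ball 0 1) := fun K => by
    rw [show P K = fun z => ∏ i ∈ T K, blaschkeFactor (A i) z from funext (hPT K)]
    exact diffContOnCl_prod_blaschkeFactor _ hA1
  have hPc : ∀ K, Continuous fun t : ℝ => P K (Complex.exp (t * I)) := fun K => by
    simp_rw [hPT K]
    exact continuous_prod_blaschkeFactor _ hA1
  have hP1 : ∀ K (t : ℝ), ‖P K (Complex.exp (t * I))‖ = 1 := fun K t => by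
    rw [hPT, norm_prod]
    exact Finset.prod_eq_one fun i _ =>
      norm_blaschkeFactor_eq_one (hA0 i) (hA1 i) (Complex.norm_exp_ofReal_mul_I t)
  obtain ⟨β, hβm, hβ⟩ := measurable_limit_of_tendsto_metrizable_ae
    (fun K => (hPc K).measurable.aemeasurable) (ae_tendsto_prod_blaschkeFactor h0 h1 hC)
  have hβ1 : ∀ᵐ θ ∂(volume.restrict (Ioc 0 (2 * π))), ‖β θ‖ = 1 := by
    filter_upwards [hβ] with θ hθ
    exact tendsto_nhds_unique hθ.norm (by simp only [hP1]; exact tendsto_const_nhds)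
  have hβi : IntegrableOn β (Ioc 0 (2 * π)) :=
    Integrable.of_bound hβm.aestronglyMeasurable 1 (hβ1.mono fun _ h => h.le)
  have hpoisson : ∀ (θ r : ℝ), r ∈ Ioo (0:ℝ) 1 →
      poissonIntegral β r θ = blaschkeProd 0 1 A (r * Complex.exp (θ * I)) := by
    intro θ r hr
    have hr' : |r| < 1 := by rw [abs_of_pos hr.1]; exact hr.2
    have hz : ‖(r : ℂ) * Complex.exp (θ * I)‖ < 1 := by
      rw [norm_mul, Complex.norm_exp_ofReal_mul_I, Complex.norm_real, mul_one]; exact hr'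
    refine tendsto_nhds_unique ?_ (hlim _ hz)
    simp_rw [← (hPd _).poissonIntegral_eq hr.1.le hr.2 θ]
    refine Tendsto.const_smul ?_ _
    rw [intervalIntegral.integral_of_le Real.two_pi_pos.le]
    simp_rw [intervalIntegral.integral_of_le Real.two_pi_pos.le]
    have hk : Continuous fun t => discKernel r (θ - t) :=
      (continuous_discKernel hr').comp (continuous_const.sub continuous_id)
    obtain ⟨c, hc⟩ := (isCompact_Icc (a := 0) (b := 2 * π)).exists_bound_of_continuousOn
      hk.continuousOn
    refine tendsto_integral_filter_of_norm_le_const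
      (.of_forall fun K => (hk.smul (hPc K)).aestronglyMeasurable) ⟨c, .of_forall fun K => ?_⟩ ?_
    · filter_upwards [ae_restrict_mem measurableSet_Ioc] with t ht
      rw [norm_smul, hP1, mul_one]
      exact hc t (Ioc_subset_Icc_self ht)
    · filter_upwards [hβ] with t ht
      exact ht.const_smul _
  have hrad : ∀ᵐ θ ∂(volume.restrict (Ioc 0 (2 * π))), ‖β θ‖ = 1 ∧
      Tendsto (fun r : ℝ => blaschkeProd 0 1 A (r * Complex.exp (θ * I))) (𝓝[<] 1) (𝓝 (β θ)) := by
    filter_upwards [hβ1, tendsto_poissonIntegral hβi] with θ h2 h3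
    refine ⟨h2, h3.congr' ?_⟩
    filter_upwards [Ioo_mem_nhdsLT one_pos] with r hr using hpoisson θ r hr
  refine ⟨blaschkeProd 0 1 A, β, ⟨differentiableOn_blaschkeProd hA0 hA1 hs,
    ⟨1, fun z hz => norm_blaschkeProd_le_one hA0 hA1 hs (by simpa using hz)⟩, ?_⟩,
    ⟨0, 1, _, inferInstance, A, norm_one, fun i => ⟨hA0 i, hA1 i⟩, hs, fun _ _ => rfl⟩, ?_⟩
  · filter_upwards [hrad] with θ h using ⟨β θ, h⟩
  · filter_upwards [hrad, hβ] with θ h h2 using ⟨h.1, h.2, h2⟩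

end BlockBoundary

section CircleFactor

/-- The values on the unit circle of the Blaschke factor with zero `ρ > 0`. -/
noncomputable def circleFactor (ρ y : ℝ) : ℂ :=
  (ρ - Complex.exp (y * I)) / (1 - ρ * Complex.exp (y * I))

variable {ρ : ℝ}

lemma blaschkeFactor_polar (h0 : 0 < ρ) (α x : ℝ) :
    blaschkeFactor (ρ * Complex.exp (α * I)) (Complex.exp (x * I)) = circleFactor ρ (x - α) := by
  have hρ : (ρ : ℂ) ≠ 0 := by exact_mod_cast h0.ne'
  have he : Complex.exp (α * I) ≠ 0 := Complex.exp_ne_zero _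
  have hx : Complex.exp (x * I) = Complex.exp (α * I) * Complex.exp ((x - α : ℝ) * I) := by
    rw [← Complex.exp_add]; congr 1; push_cast; ring
  have hc : (starRingEnd ℂ) (Complex.exp (α * I)) * Complex.exp (α * I) = 1 := by
    rw [Complex.conj_mul', Complex.norm_exp_ofReal_mul_I]; norm_num
  have hn : ‖(ρ : ℂ) * Complex.exp (α * I)‖ = ρ := by
    rw [norm_mul, Complex.norm_exp_ofReal_mul_I, Complex.norm_real, mul_one,
      Real.norm_of_nonneg h0.le]
  rw [blaschkeFactor, hn, circleFactor, map_mul, Complex.conj_ofReal, hx]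
  have e : (ρ : ℂ) * (starRingEnd ℂ) (Complex.exp (α * I)) *
      (Complex.exp (α * I) * Complex.exp ((x - α : ℝ) * I))
      = ρ * Complex.exp ((x - α : ℝ) * I) := by
    linear_combination ρ * Complex.exp ((x - α : ℝ) * I) * hc
  rw [e, ← mul_div_assoc]
  congr 1
  field_simp

lemma one_sub_mul_exp_ne_zero (h0 : 0 < ρ) (h1 : ρ < 1) (y : ℝ) :
    1 - ρ * Complex.exp (y * I) ≠ 0 := by
  have := one_sub_conj_mul_ne_zero (a := ρ) (z := Complex.exp (y * I))
    (by rwa [Complex.norm_real, Real.norm_of_nonneg h0.le]) (Complex.norm_exp_ofReal_mul_I y).le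
  rwa [Complex.conj_ofReal] at this

lemma norm_circleFactor (h0 : 0 < ρ) (h1 : ρ < 1) (y : ℝ) : ‖circleFactor ρ y‖ = 1 := by
  have h := blaschkeFactor_polar h0 0 y
  rw [sub_zero] at h
  rw [← h]
  have hn : ‖(ρ : ℂ) * Complex.exp ((0:ℝ) * I)‖ = ρ := by
    rw [norm_mul, Complex.norm_exp_ofReal_mul_I, Complex.norm_real, mul_one,
      Real.norm_of_nonneg h0.le]
  exact norm_blaschkeFactor_eq_one (norm_pos_iff.1 (by rwa [hn])) (by rwa [hn])
    (Complex.norm_exp_ofReal_mul_I y)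

lemma hasDerivAt_circleFactor (h0 : 0 < ρ) (h1 : ρ < 1) (y : ℝ) :
    HasDerivAt (circleFactor ρ) (I * discKernel ρ y * circleFactor ρ y) y := by
  have he : HasDerivAt (fun y : ℝ => Complex.exp (y * I)) (Complex.exp (y * I) * I) y := by
    have := ((hasDerivAt_id y).ofReal_comp.mul_const I).cexp
    simpa using this
  have hne := one_sub_mul_exp_ne_zero h0 h1 y
  have h := (he.const_sub (ρ : ℂ)).div ((he.const_mul (ρ : ℂ)).const_sub 1) hne
  refine h.congr_deriv ?_
  have hconj : (starRingEnd ℂ) (Complex.exp (y * I)) * Complex.exp (y * I) = 1 := by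
    rw [Complex.conj_mul', Complex.norm_exp_ofReal_mul_I]; norm_num
  have hne2 : Complex.exp (y * I) - ρ ≠ 0 := by
    intro h2
    have h3 : Complex.exp (y * I) = ρ := sub_eq_zero.1 h2
    have h4 := Complex.norm_exp_ofReal_mul_I y
    rw [h3, Complex.norm_real, Real.norm_of_nonneg h0.le] at h4
    linarith
  have hk : (discKernel ρ y : ℂ) * ((1 - ρ * Complex.exp (y * I)) * (Complex.exp (y * I) - ρ))
      = (1 - ρ ^ 2) * Complex.exp (y * I) := by
    rw [discKernel_eq]
    push_cast
    have hn : ((‖Complex.exp (y * I) - ρ‖ : ℂ)) ^ 2 * Complex.exp (y * I)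
        = (1 - ρ * Complex.exp (y * I)) * (Complex.exp (y * I) - ρ) := by
      rw [← Complex.conj_mul', map_sub, Complex.conj_ofReal]
      linear_combination (Complex.exp (y * I) - ρ) * hconj
    rw [← hn]
    have : (‖Complex.exp (y * I) - ρ‖ : ℂ) ≠ 0 := by
      exact_mod_cast norm_ne_zero_iff.2 hne2
    field_simp
  rw [circleFactor]
  set e := Complex.exp (y * I)
  rw [← mul_div_assoc, div_eq_div_iff (pow_ne_zero 2 hne) hne]
  linear_combination (I * (1 - ρ * e)) * hk

/-- To first order, translating a circle factor by `s` multiplies it by a unimodular constant. -/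
lemma norm_circleFactor_add_sub_le (h0 : 0 < ρ) (h1 : ρ < 1) {y s c : ℝ}
    (h : ∀ t ∈ uIcc 0 s, |discKernel ρ (y + t) - discKernel ρ y| ≤ c) :
    ‖circleFactor ρ (y + s) - Complex.exp ((s * discKernel ρ y : ℝ) * I) * circleFactor ρ y‖
      ≤ c * |s| := by
  set p := discKernel ρ y with hp
  set F : ℝ → ℂ := fun t => circleFactor ρ (y + t) * Complex.exp ((-(t * p) : ℝ) * I) with hF
  have hd : ∀ t, HasDerivAt F (I * (discKernel ρ (y + t) - p : ℝ) * F t) t := fun t => by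
    have h2 : HasDerivAt (fun t => circleFactor ρ (y + t)) _ t :=
      (hasDerivAt_circleFactor h0 h1 (y + t)).comp_const_add y t
    have h3 : HasDerivAt (fun t : ℝ => Complex.exp ((-(t * p) : ℝ) * I)) _ t :=
      ((((hasDerivAt_id t).mul_const p).neg).ofReal_comp.mul_const I).cexp
    refine (h2.mul h3).congr_deriv ?_
    simp only [hF, id_eq, Pi.neg_apply]
    push_cast
    ring
  have hFn : ∀ t, ‖F t‖ = 1 := fun t => by
    rw [hF, norm_mul, norm_circleFactor h0 h1, Complex.norm_exp_ofReal_mul_I, one_mul]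
  have hb := Convex.norm_image_sub_le_of_norm_hasDerivWithin_le (s := uIcc 0 s) (x := 0) (y := s)
    (fun t _ => (hd t).hasDerivWithinAt) (fun t ht => by
      rw [norm_mul, norm_mul, Complex.norm_I, hFn, one_mul, mul_one, Complex.norm_real]
      exact h t ht) (convex_uIcc 0 s) left_mem_uIcc right_mem_uIcc
  rw [sub_zero, Real.norm_eq_abs] at hb
  have hF0 : F 0 = circleFactor ρ y := by simp [hF]
  have e : circleFactor ρ (y + s) - Complex.exp ((s * p : ℝ) * I) * circleFactor ρ y
      = Complex.exp ((s * p : ℝ) * I) * (F s - F 0) := by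
    rw [hF0, mul_sub, hF]
    have : Complex.exp ((s * p : ℝ) * I) * Complex.exp ((-(s * p) : ℝ) * I) = 1 := by
      rw [← Complex.exp_add, ← add_mul, ← Complex.ofReal_add]; simp
    linear_combination (-circleFactor ρ (y + s)) * this
  rw [e, norm_mul, Complex.norm_exp_ofReal_mul_I, one_mul]
  exact hb

end CircleFactor

section RiemannSum

lemma abs_riemannSum_sub_integral_le {N : ℕ} (hN : 0 < N) {c : ℕ → ℝ} {h b : ℝ → ℝ}
    (hh : Continuous h) (hb : Continuous b)
    (hle : ∀ n < N, ∀ t ∈ Ioc (2 * π * n / N) (2 * π * (n + 1 : ℕ) / N), |c n - h t| ≤ b t) :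
    |∑ n ∈ Finset.range N, c n / N - (2 * π)⁻¹ * ∫ t in (0:ℝ)..(2 * π), h t|
      ≤ (2 * π)⁻¹ * ∫ t in (0:ℝ)..(2 * π), b t := by
  have hN' : (0:ℝ) < N := by exact_mod_cast hN
  have h2π := Real.two_pi_pos
  have hsum : ∀ f : ℝ → ℝ, Continuous f → ∑ n ∈ Finset.range N,
      ∫ t in (2 * π * n / N)..(2 * π * (n + 1 : ℕ) / N), f t = ∫ t in (0:ℝ)..(2 * π), f t := by
    intro f hf
    have := intervalIntegral.sum_integral_adjacent_intervals (f := f) (μ := volume)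
      (a := fun n : ℕ => 2 * π * n / N) (n := N) fun k _ => hf.intervalIntegrable _ _
    rw [this]
    congr 1
    · simp
    · field_simp
  have hc : ∀ n : ℕ, c n / N
      = (2 * π)⁻¹ * ∫ _t in (2 * π * n / N)..(2 * π * (n + 1 : ℕ) / N), c n := fun n => by
    rw [intervalIntegral.integral_const, smul_eq_mul]
    push_cast
    field_simp
    ring
  rw [Finset.sum_congr rfl fun n _ => hc n, ← Finset.mul_sum, ← mul_sub, ← hsum h hh,
    ← Finset.sum_sub_distrib, abs_mul, abs_of_pos (inv_pos.2 h2π), ← hsum b hb]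
  gcongr
  refine (Finset.abs_sum_le_sum_abs _ _).trans (Finset.sum_le_sum fun n hn => ?_)
  rw [← intervalIntegral.integral_sub intervalIntegrable_const (hh.intervalIntegrable _ _),
    ← Real.norm_eq_abs]
  refine intervalIntegral.norm_integral_le_of_norm_le ?_ ?_ (hb.intervalIntegrable _ _)
  · push_cast
    gcongr
    linarith
  · exact ae_of_all _ fun t ht => hle n (Finset.mem_range.1 hn) t ht

end RiemannSum

section Periodic

/-- A continuous `2π`-periodic function varies little between points whose difference has cosine
close to `1`. -/
lemma exists_cos_lt_imp_abs_sub_le {g : ℝ → ℝ} (hg : Continuous g)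
    (hper : Function.Periodic g (2 * π)) {η : ℝ} (hη : 0 < η) :
    ∃ c < 1, ∀ x t, c < Real.cos (x - t) → |g t - g x| ≤ η := by
  have huc : UniformContinuousOn g (Icc (-π) (3 * π)) :=
    isCompact_Icc.uniformContinuousOn_of_continuous hg.continuousOn
  obtain ⟨δ, hδ, hd⟩ := Metric.uniformContinuousOn_iff.1 huc η hη
  have hπ := Real.pi_pos
  set d := min δ 1 with hdd
  have hd0 : 0 < d := lt_min hδ one_pos
  have hdπ : d ≤ π := (min_le_right _ _).trans (by linarith [Real.pi_gt_three])
  refine ⟨Real.cos d, ?_, fun x t hxt => ?_⟩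
  · rw [← Real.cos_zero]
    exact Real.cos_lt_cos_of_nonneg_of_le_pi le_rfl hdπ hd0
  set t₀ := toIcoMod Real.two_pi_pos 0 t with ht₀
  set y := toIocMod Real.two_pi_pos (-π) (x - t) with hy
  have ht₀m : t₀ ∈ Ico 0 (0 + 2 * π) := toIcoMod_mem_Ico _ _ _
  have hym : y ∈ Ioc (-π) (-π + 2 * π) := toIocMod_mem_Ioc _ _ _
  have e1 : t₀ = t - toIcoDiv Real.two_pi_pos 0 t * (2 * π) := by
    rw [ht₀, toIcoMod, zsmul_eq_mul]
  have e2 : y = x - t - toIocDiv Real.two_pi_pos (-π) (x - t) * (2 * π) := by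
    rw [hy, toIocMod, zsmul_eq_mul]
  have hcy : Real.cos y = Real.cos (x - t) := by
    rw [e2, Real.cos_sub_int_mul_two_pi]
  have hyd : |y| < d := by
    by_contra! hcon
    have : Real.cos |y| ≤ Real.cos d := Real.cos_le_cos_of_nonneg_of_le_pi hd0.le
      (abs_le.2 ⟨by linarith [hym.1], by linarith [hym.2]⟩) hcon
    rw [Real.cos_abs, hcy] at this
    linarith
  have hgt : g t = g t₀ := by rw [e1, hper.sub_int_mul_eq]
  have hgx : g x = g (t₀ + y) := by
    have : t₀ + y = x - ((toIcoDiv Real.two_pi_pos 0 t + toIocDiv Real.two_pi_pos (-π) (x - t) : ℤ))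
        * (2 * π) := by
      rw [e1, e2]; push_cast; ring
    rw [this, hper.sub_int_mul_eq]
  have hyabs := abs_lt.1 hyd
  rw [hgt, hgx, ← Real.dist_eq]
  refine (hd _ ⟨?_, ?_⟩ _ ⟨?_, ?_⟩ ?_).le
  · linarith [ht₀m.1]
  · linarith [ht₀m.2]
  · linarith [ht₀m.1]
  · linarith [ht₀m.2]
  · rw [Real.dist_eq, show t₀ - (t₀ + y) = -y by ring, abs_neg]
    exact hyd.trans_le (min_le_left _ _)

end Periodic

section KernelSums

variable {ρ κ : ℝ} {N : ℕ} {α : ℕ → ℝ}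

lemma sum_discKernel_le (h0 : 0 < ρ) (h1 : ρ < 1) (hκ0 : 0 ≤ κ) (hκ1 : κ ≤ 1) (hN : 0 < N)
    (hNκ : 2 * π / N ≤ κ * (1 - ρ))
    (hα : ∀ n < N, ∀ t ∈ Ioc (2 * π * n / N) (2 * π * (n + 1 : ℕ) / N), |α n - t| ≤ 2 * π / N)
    (x : ℝ) : ∑ n ∈ Finset.range N, discKernel ρ (x - α n) / N ≤ 4 := by
  have hρ : |ρ| < 1 := by rwa [abs_of_pos h0]
  have hP : Continuous fun t => discKernel ρ (x - t) :=
    (continuous_discKernel hρ).comp (continuous_const.sub continuous_id)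
  have h := abs_riemannSum_sub_integral_le hN (c := fun n => discKernel ρ (x - α n)) hP
    (hP.const_mul (3 * κ)) fun n hn t ht => abs_discKernel_sub_le h0.le h1 hκ0 hκ1 (by
      rw [show x - α n - (x - t) = -(α n - t) by ring, abs_neg]
      exact (hα n hn t ht).trans hNκ)
  rw [intervalIntegral.integral_const_mul, integral_discKernel h0.le h1] at h
  have h2 := (abs_le.1 h).2
  have e : (2 * π)⁻¹ * (2 * π) = 1 := inv_mul_cancel₀ Real.two_pi_pos.ne'
  have e' : (2 * π)⁻¹ * (3 * κ * (2 * π)) = 3 * κ := by linear_combination 3 * κ * e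
  rw [e, e'] at h2
  linarith

lemma abs_sum_mul_discKernel_sub_le (h0 : 0 < ρ) (h1 : ρ < 1) (hκ0 : 0 ≤ κ) (hκ1 : κ ≤ 1)
    (hN : 0 < N) (hNκ : 2 * π / N ≤ κ * (1 - ρ))
    (hα : ∀ n < N, ∀ t ∈ Ioc (2 * π * n / N) (2 * π * (n + 1 : ℕ) / N), |α n - t| ≤ 2 * π / N)
    {g : ℝ → ℝ} {G η c : ℝ} (hG : ∀ t, |g t| ≤ G) (hη : 0 ≤ η) (hc : c < 1)
    (hgc : ∀ x t, c < Real.cos (x - t) → |g t - g x| ≤ η)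
    (hcN : ∀ u, |u| ≤ 2 * π / N → c < Real.cos u) (x : ℝ) :
    |∑ n ∈ Finset.range N, g (α n) * discKernel ρ (x - α n) / N - g x|
      ≤ 5 * η + 3 * G * κ + 2 * G * ((1 - ρ ^ 2) / (2 * ρ * (1 - c))) := by
  have hρ : |ρ| < 1 := by rwa [abs_of_pos h0]
  have hG0 : 0 ≤ G := (abs_nonneg _).trans (hG 0)
  set K := (1 - ρ ^ 2) / (2 * ρ * (1 - c)) with hK
  have hK0 : 0 ≤ K := div_nonneg (by nlinarith) (mul_nonneg (by linarith) (by linarith))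
  have hP : Continuous fun t => discKernel ρ (x - t) :=
    (continuous_discKernel hρ).comp (continuous_const.sub continuous_id)
  have h := abs_riemannSum_sub_integral_le hN
    (c := fun n => g (α n) * discKernel ρ (x - α n)) (hP.const_mul (g x))
    (b := fun t => (5 * η + 3 * G * κ) * discKernel ρ (x - t) + 2 * G * K)
    ((hP.const_mul _).add continuous_const) ?_
  · rw [intervalIntegral.integral_add ((hP.const_mul _).intervalIntegrable _ _) (by simp),
      intervalIntegral.integral_const_mul, intervalIntegral.integral_const_mul,
      integral_discKernel h0.le h1, intervalIntegral.integral_const, smul_eq_mul] at h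
    have e : (2 * π)⁻¹ * (2 * π) = 1 := inv_mul_cancel₀ Real.two_pi_pos.ne'
    have e1 : (2 * π)⁻¹ * (g x * (2 * π)) = g x := by linear_combination g x * e
    have e2 : (2 * π)⁻¹ * ((5 * η + 3 * G * κ) * (2 * π) + (2 * π - 0) * (2 * G * K))
        = 5 * η + 3 * G * κ + 2 * G * K := by
      linear_combination (5 * η + 3 * G * κ + 2 * G * K) * e
    rwa [e1, e2] at h
  · intro n hn t ht
    have hαt := hα n hn t ht
    set p := discKernel ρ (x - t) with hp
    set p' := discKernel ρ (x - α n) with hp'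
    have hp0 : 0 ≤ p := discKernel_nonneg hρ _
    have hpp : |p' - p| ≤ 3 * κ * p := abs_discKernel_sub_le h0.le h1 hκ0 hκ1 (by
      rw [show x - α n - (x - t) = -(α n - t) by ring, abs_neg]
      exact hαt.trans hNκ)
    have hp'4 : p' ≤ 4 * p := by
      have := (abs_le.1 hpp).2
      nlinarith
    have hp'0 : 0 ≤ p' := discKernel_nonneg hρ _
    have a1 : |(g (α n) - g t) * p'| ≤ η * (4 * p) := by
      rw [abs_mul, abs_of_nonneg hp'0]
      refine mul_le_mul (hgc t (α n) (hcN _ ?_)) hp'4 hp'0 hη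
      rwa [abs_sub_comm]
    have a2 : |g t * (p' - p)| ≤ G * (3 * κ * p) := by
      rw [abs_mul]
      exact mul_le_mul (hG t) hpp (abs_nonneg _) hG0
    have a3 : |(g t - g x) * p| ≤ η * p + 2 * G * K := by
      rw [abs_mul, abs_of_nonneg hp0]
      have h2G : |g t - g x| ≤ 2 * G := by
        have := abs_sub (g t) (g x)
        linarith [hG t, hG x]
      rcases lt_or_ge c (Real.cos (x - t)) with hcase | hcase
      · have := mul_le_mul_of_nonneg_right (hgc x t hcase) hp0
        have : 0 ≤ 2 * G * K := by positivity
        linarith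
      · have hpK : p ≤ K := discKernel_le_of_cos_le h0 h1 hc hcase
        have := mul_le_mul h2G hpK hp0 (by positivity)
        have : 0 ≤ η * p := by positivity
        linarith
    have e : g (α n) * p' - g x * p = (g (α n) - g t) * p' + g t * (p' - p) + (g t - g x) * p := by
      ring
    rw [e]
    refine (abs_add_three _ _ _).trans ?_
    linarith

end KernelSums

section Block

lemma card_mul_le_volume_ne_zero {g : ℝ → ℝ} {N : ℕ} (hN : 0 < N) {S : Finset ℕ}
    (hSN : ∀ n ∈ S, n < N)
    (hS : ∀ n ∈ S, ∀ t ∈ Ioc (2 * π * n / N) (2 * π * (n + 1 : ℕ) / N), g t ≠ 0) :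
    S.card * (2 * π / N) ≤ volume.real (Ioc 0 (2 * π) ∩ {t | g t ≠ 0}) := by
  have hN' : (0:ℝ) < N := by exact_mod_cast hN
  have hπ := Real.pi_pos
  have hmono : Monotone fun n : ℕ => 2 * π * n / N := fun m n hmn => by
    have : (m:ℝ) ≤ n := by exact_mod_cast hmn
    change 2 * π * m / N ≤ 2 * π * n / N
    gcongr
  have hdisj : Pairwise (Function.onFun Disjoint
      fun n : ℕ => Ioc (2 * π * n / N) (2 * π * (n + 1 : ℕ) / N)) :=
    hmono.pairwise_disjoint_on_Ioc_succ
  have hunion := measureReal_biUnion_finset (μ := volume) (s := S)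
    (f := fun n : ℕ => Ioc (2 * π * n / N) (2 * π * (n + 1 : ℕ) / N))
    (fun m _ n _ hmn => hdisj hmn) (fun _ _ => measurableSet_Ioc)
    (fun _ _ => by simp)
  have hcell : ∀ n ∈ S, volume.real (Ioc (2 * π * n / N) (2 * π * (n + 1 : ℕ) / N)) = 2 * π / N :=
    fun n _ => by
      rw [Real.volume_real_Ioc_of_le (hmono n.le_succ)]
      push_cast
      ring
  rw [Finset.sum_congr rfl hcell, Finset.sum_const, nsmul_eq_mul] at hunion
  rw [← hunion]
  refine measureReal_mono (iUnion₂_subset fun n hn t ht => ⟨⟨?_, ?_⟩, hS n hn t ht⟩)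
    ((measure_mono inter_subset_left).trans_lt measure_Ioc_lt_top).ne
  · exact lt_of_le_of_lt (by positivity) ht.1
  · refine ht.2.trans ?_
    rw [div_le_iff₀ hN']
    have : ((n + 1 : ℕ) : ℝ) ≤ N := by exact_mod_cast hSN n hn
    gcongr

lemma norm_prod_div_prod_sub_exp_le {S : Finset ℕ} {B B' : ℕ → ℂ} {s : ℕ → ℝ} {e : ℕ → ℝ}
    {γ E : ℝ} (hB : ∀ n, ‖B n‖ = 1) (hB' : ∀ n, ‖B' n‖ = 1)
    (hBB : ∀ n ∈ S, ‖B n - Complex.exp (s n * I) * B' n‖ ≤ e n)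
    (hs : |∑ n ∈ S, s n - γ| ≤ E) :
    ‖(∏ n ∈ S, B n) / (∏ n ∈ S, B' n) - Complex.exp (γ * I)‖ ≤ ∑ n ∈ S, e n + E := by
  have hB'0 : ∀ n, B' n ≠ 0 := fun n h => by simpa [h] using hB' n
  have h1 : ‖(∏ n ∈ S, B n / B' n) - ∏ n ∈ S, Complex.exp (s n * I)‖ ≤ ∑ n ∈ S, e n := by
    refine (norm_prod_sub_prod_le S (fun n _ => ?_) fun n _ => ?_).trans
      (Finset.sum_le_sum fun n hn => ?_)
    · rw [norm_div, hB, hB', div_one]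
    · exact (Complex.norm_exp_ofReal_mul_I _).le
    · refine le_trans (le_of_eq ?_) (hBB n hn)
      rw [show B n / B' n - Complex.exp (s n * I) = (B n - Complex.exp (s n * I) * B' n) / B' n by
        rw [sub_div, mul_div_cancel_right₀ _ (hB'0 n)], norm_div, hB', div_one]
  have h2 : ∏ n ∈ S, Complex.exp (s n * I) = Complex.exp ((∑ n ∈ S, s n : ℝ) * I) := by
    rw [← Complex.exp_sum, Complex.ofReal_sum, Finset.sum_mul]
  have h3 := (norm_exp_sub_exp_le (∑ n ∈ S, s n) γ).trans hs
  rw [h2] at h1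
  rw [← Finset.prod_div_distrib]
  exact (norm_sub_le_norm_sub_add_norm_sub _ _ _).trans (add_le_add h1 h3)

/-- A unimodular function `exp (g * I)` with `g` continuous and bounded by `G` is uniformly close
to a quotient of two finite Blaschke products whose zeros have total defect controlled by the
measure of the set where `g` does not vanish. -/
lemma exists_finite_blaschke_quotient {G η : ℝ} (hG : 0 ≤ G) (hη : 0 < η) :
    ∃ M > 0, ∀ g : ℝ → ℝ, Continuous g → Function.Periodic g (2 * π) → (∀ t, |g t| ≤ G) →
      ∃ (S : Finset ℕ) (a a' : ℕ → ℂ), (∀ n, a n ≠ 0) ∧ (∀ n, ‖a n‖ < 1) ∧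
        (∀ n, a' n ≠ 0) ∧ (∀ n, ‖a' n‖ < 1) ∧
        ∑ n ∈ S, (1 - ‖a n‖) ≤ M * volume.real (Ioc 0 (2 * π) ∩ {t | g t ≠ 0}) ∧
        ∑ n ∈ S, (1 - ‖a' n‖) ≤ M * volume.real (Ioc 0 (2 * π) ∩ {t | g t ≠ 0}) ∧
        ∀ θ : ℝ, ‖(∏ n ∈ S, blaschkeFactor (a n) (Complex.exp (θ * I))) /
          (∏ n ∈ S, blaschkeFactor (a' n) (Complex.exp (θ * I))) - Complex.exp (g θ * I)‖ ≤ η := by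
  have hπ := Real.pi_pos
  set κ : ℝ := min 1 (η / (30 * (G + 1))) with hκ
  have hκ0 : 0 < κ := lt_min one_pos (by positivity)
  have hκ1 : κ ≤ 1 := min_le_left _ _
  have hκG : 15 * κ * G ≤ η / 2 := by
    have h1 : κ ≤ η / (30 * (G + 1)) := min_le_right _ _
    rw [le_div_iff₀ (by positivity)] at h1
    linarith
  set M : ℝ := (2 * π + G) / κ with hM
  have hM0 : 0 < M := by positivity
  refine ⟨M, hM0, fun g hg hper hgG => ?_⟩
  obtain ⟨c, hc, hgc⟩ := exists_cos_lt_imp_abs_sub_le hg hper (show 0 < η / 20 by positivity)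
  have hlim : ∀ C : ℝ, Tendsto (fun N : ℕ => C / N) atTop (𝓝 0) := fun C =>
    tendsto_const_div_atTop_nhds_zero_nat C
  have hcos : ∀ᶠ N : ℕ in atTop, ∀ u, |u| ≤ 2 * π / N → c < Real.cos u := by
    have h1 : ∀ᶠ u : ℝ in 𝓝 0, c < Real.cos u :=
      (Real.continuous_cos.tendsto 0).eventually (lt_mem_nhds (by rwa [Real.cos_zero]))
    obtain ⟨δ, hδ, h2⟩ := Metric.eventually_nhds_iff.1 h1
    filter_upwards [(hlim (2 * π)).eventually (gt_mem_nhds hδ)] with N hN u hu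
    exact h2 (by rw [Real.dist_eq, sub_zero]; exact hu.trans_lt hN)
  obtain ⟨N, hcN, hMN, hGN, hN⟩ := (hcos.and (((hlim M).eventually
    (gt_mem_nhds (show (0:ℝ) < 1 / 2 by norm_num))).and (((hlim (4 * G * M / (1 - c))).eventually
    (gt_mem_nhds (show (0:ℝ) < η / 4 by positivity))).and (eventually_gt_atTop 0)))).exists
  have hN' : (0:ℝ) < N := by exact_mod_cast hN
  set ρ : ℝ := 1 - M / N with hρ
  have hρ1 : ρ < 1 := by
    have : 0 < M / N := by positivity
    linarith
  have hρ2 : 1 / 2 < ρ := by linarith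
  have hρ0 : 0 < ρ := by linarith
  have hκρ : κ * (1 - ρ) = (2 * π + G) / N := by
    rw [hρ, hM]; field_simp; ring
  have hNκ : 2 * π / N ≤ κ * (1 - ρ) := by
    rw [hκρ]; gcongr; linarith
  have hGκ : G / N ≤ κ * (1 - ρ) := by
    rw [hκρ]; gcongr; linarith
  have hcell : ∀ n : ℕ, ∃ t ∈ Ioc (2 * π * n / N) (2 * π * (n + 1 : ℕ) / N),
      g t = 0 ∨ ∀ u ∈ Ioc (2 * π * n / N) (2 * π * (n + 1 : ℕ) / N), g u ≠ 0 := fun n => by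
    by_cases h : ∃ t ∈ Ioc (2 * π * n / N) (2 * π * (n + 1 : ℕ) / N), g t = 0
    · obtain ⟨t, ht, h0⟩ := h
      exact ⟨t, ht, Or.inl h0⟩
    · push Not at h
      refine ⟨2 * π * (n + 1 : ℕ) / N, ⟨?_, le_rfl⟩, Or.inr h⟩
      gcongr
      exact n.lt_succ_self
  choose α hα hα0 using hcell
  have hαt : ∀ n < N, ∀ t ∈ Ioc (2 * π * n / N) (2 * π * (n + 1 : ℕ) / N),
      |α n - t| ≤ 2 * π / N := fun n _ t ht => by
    have h1 := hα n
    have e : 2 * π * (n + 1 : ℕ) / N = 2 * π * n / N + 2 * π / N := by push_cast; ring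
    rw [e] at h1 ht
    exact abs_le.2 ⟨by linarith [h1.1, ht.2], by linarith [h1.2, ht.1]⟩
  set S : Finset ℕ := (Finset.range N).filter fun n => g (α n) ≠ 0 with hS
  have hnorm : ∀ β : ℝ, ‖(ρ : ℂ) * Complex.exp (β * I)‖ = ρ := fun β => by
    rw [norm_mul, Complex.norm_exp_ofReal_mul_I, Complex.norm_real, mul_one,
      Real.norm_of_nonneg hρ0.le]
  have hmass : ∑ _n ∈ S, (1 - ρ) ≤ M * volume.real (Ioc 0 (2 * π) ∩ {t | g t ≠ 0}) := by
    have h1 := card_mul_le_volume_ne_zero (g := g) hN (S := S)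
      (fun n hn => Finset.mem_range.1 (Finset.mem_filter.1 hn).1)
      (fun n hn => (hα0 n).resolve_left (Finset.mem_filter.1 hn).2)
    rw [Finset.sum_const, nsmul_eq_mul]
    have h2 : (S.card : ℝ) * (1 - ρ) ≤ M * (S.card * (2 * π / N)) := by
      have : (S.card : ℝ) * (1 - ρ) = M * (S.card * (1 / N)) := by rw [hρ]; ring
      rw [this]
      gcongr
      linarith [Real.pi_gt_three]
    exact h2.trans (by gcongr)
  have hρabs : |ρ| < 1 := by rwa [abs_of_pos hρ0]
  refine ⟨S, fun n => ρ * Complex.exp ((α n - g (α n) / N : ℝ) * I),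
    fun n => ρ * Complex.exp (α n * I), fun n => ?_, fun n => ?_, fun n => ?_, fun n => ?_, ?_, ?_,
    fun x => ?_⟩
  · exact norm_pos_iff.1 (by rwa [hnorm])
  · rwa [hnorm]
  · exact norm_pos_iff.1 (by rwa [hnorm])
  · rwa [hnorm]
  · simpa only [hnorm] using hmass
  · simpa only [hnorm] using hmass
  · simp only [blaschkeFactor_polar hρ0]
    have hdisp : ∀ n, |g (α n) / N| ≤ G / N := fun n => by
      rw [abs_div, abs_of_pos hN']
      gcongr
      exact hgG _
    have h1 := norm_prod_div_prod_sub_exp_le (S := S)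
      (B := fun n => circleFactor ρ (x - (α n - g (α n) / N)))
      (B' := fun n => circleFactor ρ (x - α n))
      (s := fun n => g (α n) / N * discKernel ρ (x - α n))
      (e := fun n => 3 * κ * discKernel ρ (x - α n) * (G / N)) (γ := g x)
      (E := 5 * (η / 20) + 3 * G * κ + 2 * G * ((1 - ρ ^ 2) / (2 * ρ * (1 - c))))
      (fun n => norm_circleFactor hρ0 hρ1 _) (fun n => norm_circleFactor hρ0 hρ1 _)
      (fun n _ => ?_) ?_
    · refine h1.trans ?_
      have h2 : ∑ n ∈ S, 3 * κ * discKernel ρ (x - α n) * (G / N) ≤ 3 * κ * G * 4 := by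
        refine (Finset.sum_le_sum_of_subset_of_nonneg (Finset.filter_subset _ _)
          fun n _ _ => ?_).trans ?_
        · have := discKernel_nonneg hρabs (x - α n)
          positivity
        · rw [Finset.sum_congr rfl fun n _ => show 3 * κ * discKernel ρ (x - α n) * (G / N)
            = 3 * κ * G * (discKernel ρ (x - α n) / N) by ring, ← Finset.mul_sum]
          gcongr
          exact sum_discKernel_le hρ0 hρ1 hκ0.le hκ1 hN hNκ hαt x
      have h3 : 2 * G * ((1 - ρ ^ 2) / (2 * ρ * (1 - c))) ≤ η / 4 := by
        refine le_trans ?_ hGN.le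
        have hc' : 0 < 1 - c := by linarith
        have h4 : (1 - ρ ^ 2) / (2 * ρ * (1 - c)) ≤ 2 * (M / N) / (1 * (1 - c)) := by
          have : 1 - ρ ^ 2 = (1 + ρ) * (M / N) := by rw [hρ]; ring
          rw [this]
          gcongr <;> linarith
        refine (mul_le_mul_of_nonneg_left h4 (by positivity)).trans (le_of_eq ?_)
        field_simp
        ring
      linarith
    · rw [show x - (α n - g (α n) / N) = x - α n + g (α n) / N by ring]
      refine (norm_circleFactor_add_sub_le hρ0 hρ1 fun t ht =>
        abs_discKernel_sub_le hρ0.le hρ1 hκ0.le hκ1 ?_).trans ?_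
      · rw [add_sub_cancel_left]
        have : |t| ≤ |g (α n) / N| := by
          have := abs_sub_left_of_mem_uIcc ht
          simpa using this
        exact this.trans ((hdisp n).trans hGκ)
      · have := discKernel_nonneg hρabs (x - α n)
        gcongr
        exact hdisp n
    · have h2 := abs_sum_mul_discKernel_sub_le hρ0 hρ1 hκ0.le hκ1 hN hNκ hαt hgG
        (by positivity) hc hgc hcN x
      have e : ∑ n ∈ S, g (α n) / N * discKernel ρ (x - α n)
          = ∑ n ∈ Finset.range N, g (α n) * discKernel ρ (x - α n) / N := by
        rw [hS, Finset.sum_filter_of_ne]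
        · exact Finset.sum_congr rfl fun n _ => by ring
        · intro n _ hne h0
          simp [h0] at hne
      rwa [e]

end Block

section PoissonRegularity

variable {r : ℝ}

lemma poissonIntegral_periodic {E : Type*} [NormedAddCommGroup E] [NormedSpace ℝ E] (ψ : ℝ → E)
    (r : ℝ) : Function.Periodic (poissonIntegral ψ r) (2 * π) := fun θ => by
  simp only [poissonIntegral, discKernel, show ∀ t, θ + 2 * π - t = θ - t + 2 * π from
    fun t => by ring, Real.cos_add_two_pi]

lemma discKernel_le (h0 : 0 < r) (h1 : r < 1) (y : ℝ) :
    discKernel r y ≤ (1 - r ^ 2) / (1 - r) ^ 2 := by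
  unfold discKernel
  apply div_le_div_of_nonneg_left
  · nlinarith
  · exact pow_pos (by linarith) 2
  · nlinarith [Real.cos_le_one y]

lemma continuous_poissonIntegral {ψ : ℝ → ℝ} (hψ : Measurable ψ) {G : ℝ} (hG : ∀ t, |ψ t| ≤ G)
    (h0 : 0 < r) (h1 : r < 1) : Continuous (poissonIntegral ψ r) := by
  have hr : |r| < 1 := by rwa [abs_of_pos h0]
  suffices h : Continuous fun θ => ∫ t in (0:ℝ)..(2 * π), discKernel r (θ - t) • ψ t from
    (continuous_const (y := (2 * π)⁻¹)).smul h
  refine intervalIntegral.continuous_of_dominated_interval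
    (bound := fun _ => (1 - r ^ 2) / (1 - r) ^ 2 * G) (fun x => ?_) (fun x => ?_)
    intervalIntegrable_const ?_
  · exact (((continuous_discKernel hr).comp (continuous_const.sub continuous_id)).measurable.smul
      hψ).aestronglyMeasurable
  · refine ae_of_all _ fun t _ => ?_
    rw [norm_smul, Real.norm_of_nonneg (discKernel_nonneg hr _)]
    exact mul_le_mul (discKernel_le h0 h1 _) (hG t) (norm_nonneg _)
      ((discKernel_nonneg hr 0).trans (discKernel_le h0 h1 0))
  · exact ae_of_all _ fun t _ =>
      ((continuous_discKernel hr).comp (continuous_id.sub continuous_const)).smul continuous_const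

lemma abs_poissonIntegral_le {ψ : ℝ → ℝ} {G : ℝ} (hG : ∀ t, |ψ t| ≤ G)
    (h0 : 0 < r) (h1 : r < 1) (θ : ℝ) : |poissonIntegral ψ r θ| ≤ G := by
  have hr : |r| < 1 := by rwa [abs_of_pos h0]
  have h2π := Real.two_pi_pos
  have hc : Continuous fun t => discKernel r (θ - t) :=
    (continuous_discKernel hr).comp (continuous_const.sub continuous_id)
  have h := intervalIntegral.norm_integral_le_of_norm_le (μ := volume)
    (f := fun t => discKernel r (θ - t) • ψ t) (g := fun t => discKernel r (θ - t) * G) h2π.le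
    (ae_of_all _ fun t _ => by
      rw [norm_smul, Real.norm_of_nonneg (discKernel_nonneg hr _)]
      exact mul_le_mul_of_nonneg_left (hG t) (discKernel_nonneg hr _))
    ((hc.mul continuous_const).intervalIntegrable _ _)
  rw [intervalIntegral.integral_mul_const, integral_discKernel h0.le h1] at h
  rw [poissonIntegral, smul_eq_mul, abs_mul, abs_of_pos (inv_pos.2 h2π),
    inv_mul_le_iff₀ h2π]
  exact h

end PoissonRegularity

section Telescoping

/-- Soft thresholding at level `η`. -/
noncomputable def softThreshold (η x : ℝ) : ℝ := x - max (-η) (min x η)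

lemma continuous_softThreshold (η : ℝ) : Continuous (softThreshold η) := by
  unfold softThreshold
  fun_prop

variable {η : ℝ}

lemma softThreshold_of_abs_le {x : ℝ} (hx : |x| ≤ η) : softThreshold η x = 0 := by
  have := abs_le.1 hx
  rw [softThreshold, min_eq_left this.2, max_eq_right this.1, sub_self]

lemma abs_softThreshold_sub_le (hη : 0 ≤ η) (x : ℝ) : |softThreshold η x - x| ≤ η := by
  rw [softThreshold, sub_sub_cancel_left, abs_neg, abs_le]
  exact ⟨le_max_left _ _, max_le (by linarith) (min_le_right _ _)⟩

lemma abs_softThreshold_le (hη : 0 ≤ η) (x : ℝ) : |softThreshold η x| ≤ |x| := by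
  unfold softThreshold
  rcases le_total x η with h1 | h1
  · rw [min_eq_left h1]
    rcases le_total (-η) x with h2 | h2
    · rw [max_eq_right h2, sub_self, abs_zero]; exact abs_nonneg x
    · rw [max_eq_left h2, abs_of_nonpos (by linarith), abs_of_nonpos (by linarith)]; linarith
  · rw [min_eq_right h1, max_eq_right (by linarith), abs_of_nonneg (by linarith),
      abs_of_nonneg (by linarith)]
    linarith

lemma exists_approx_measure_le {ψ : ℝ → ℝ} (hψ : Measurable ψ) {G : ℝ} (hG : ∀ t, |ψ t| ≤ G)
    {η δ : ℕ → ℝ} (hη : ∀ k, 0 < η k) (hδ : ∀ k, 0 < δ k) :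
    ∃ h : ℕ → ℝ → ℝ, (∀ k, Continuous (h k)) ∧ (∀ k, Function.Periodic (h k) (2 * π)) ∧
      (∀ k t, |h k t| ≤ G) ∧
      (∀ᵐ θ ∂(volume.restrict (Ioc 0 (2 * π))), Tendsto (fun k => h k θ) atTop (𝓝 (ψ θ))) ∧
      ∀ k, (volume.restrict (Ioc 0 (2 * π))).real {t | η k ≤ |h k t - ψ t|} ≤ δ k := by
  set r : ℕ → ℝ := fun n => 1 - 1 / ((n : ℝ) + 2) with hr
  have hr1 : ∀ n, r n < 1 := fun n => by
    have : 0 < 1 / ((n : ℝ) + 2) := by positivity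
    simp only [hr]; linarith
  have hr0 : ∀ n, 0 < r n := fun n => by
    have : 1 / ((n : ℝ) + 2) < 1 := by
      rw [div_lt_one (by positivity)]
      linarith [Nat.cast_nonneg (α := ℝ) n]
    simp only [hr]; linarith
  have hrt : Tendsto r atTop (𝓝[<] 1) := by
    refine tendsto_nhdsWithin_iff.2 ⟨?_, .of_forall hr1⟩
    have h1 : Tendsto (fun n : ℕ => 1 / ((n : ℝ) + 2)) atTop (𝓝 0) :=
      tendsto_const_nhds.div_atTop
        (tendsto_atTop_add_const_right _ _ tendsto_natCast_atTop_atTop)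
    simpa only [sub_zero] using h1.const_sub 1
  have hψi : IntegrableOn ψ (Ioc 0 (2 * π)) :=
    Integrable.of_bound hψ.aestronglyMeasurable G (ae_of_all _ hG)
  have hlim : ∀ᵐ θ ∂(volume.restrict (Ioc 0 (2 * π))),
      Tendsto (fun n => poissonIntegral ψ (r n) θ) atTop (𝓝 (ψ θ)) := by
    filter_upwards [tendsto_poissonIntegral hψi] with θ h using h.comp hrt
  have hcont : ∀ n, Continuous (poissonIntegral ψ (r n)) := fun n =>
    continuous_poissonIntegral hψ hG (hr0 n) (hr1 n)
  have hmeas := tendstoInMeasure_iff_measureReal_norm.1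
    (tendstoInMeasure_of_tendsto_ae (fun n => (hcont n).aestronglyMeasurable) hlim)
  have hex : ∀ k, ∃ n, k ≤ n ∧ (volume.restrict (Ioc 0 (2 * π))).real
      {t | η k ≤ |poissonIntegral ψ (r n) t - ψ t|} ≤ δ k := fun k => by
    obtain ⟨n, h1, h2⟩ := (((hmeas (η k) (hη k)).eventually (gt_mem_nhds (hδ k))).and
      (eventually_ge_atTop k)).exists
    exact ⟨n, h2, h1.le⟩
  choose n hkn hn using hex
  refine ⟨fun k => poissonIntegral ψ (r (n k)), fun k => hcont _,
    fun k => poissonIntegral_periodic _ _,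
    fun k t => abs_poissonIntegral_le hG (hr0 _) (hr1 _) t, ?_, hn⟩
  filter_upwards [hlim] with θ h using h.comp (tendsto_atTop_mono hkn tendsto_id)

/-- A bounded measurable function is, up to a small uniform error, the almost everywhere sum of a
series of continuous periodic functions with rapidly decreasing supports. -/
lemma exists_continuous_series {ψ : ℝ → ℝ} (hψ : Measurable ψ) {G : ℝ} (hG : ∀ t, |ψ t| ≤ G)
    {η M : ℕ → ℝ} (hη : ∀ k, 0 < η k) (hanti : Antitone η) (hM : ∀ k, 0 < M k) :
    ∃ (g h : ℕ → ℝ → ℝ) (C : ℝ), (∀ k, Continuous (g k)) ∧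
      (∀ k, Function.Periodic (g k) (2 * π)) ∧ (∀ k t, |g k t| ≤ 2 * G) ∧
      (∀ k, M k * volume.real (Ioc 0 (2 * π) ∩ {t | g k t ≠ 0}) ≤ C * (1 / 4) ^ k) ∧
      (∀ᵐ θ ∂(volume.restrict (Ioc 0 (2 * π))), Tendsto (fun k => h k θ) atTop (𝓝 (ψ θ))) ∧
      ∀ K t, |∑ k ∈ Finset.range K, g k t - h K t| ≤ ∑ k ∈ Finset.range K, η k := by
  have hG0 : 0 ≤ G := (abs_nonneg _).trans (hG 0)
  set μ := volume.restrict (Ioc 0 (2 * π)) with hμ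
  obtain ⟨p, hpc, hpp, hpG, hpt, hpm⟩ := exists_approx_measure_le hψ hG
    (η := fun k => η (k + 1) / 2) (δ := fun k => (1 / 4) ^ k / (M k + M (k + 1)))
    (fun k => by have := hη (k + 1); positivity)
    (fun k => by have := hM k; have := hM (k + 1); positivity)
  set h : ℕ → ℝ → ℝ := fun k => Nat.casesOn k (fun _ => 0) p with hh
  have hhc : ∀ k, Continuous (h k) := by
    rintro (_ | k)
    exacts [continuous_const, hpc k]
  have hhp : ∀ k, Function.Periodic (h k) (2 * π) := by
    rintro (_ | k)
    exacts [fun _ => rfl, hpp k]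
  have hhG : ∀ k t, |h k t| ≤ G := by
    rintro (_ | k) t
    exacts [by simpa [hh] using hG0, hpG k t]
  refine ⟨fun k t => softThreshold (η k) (h (k + 1) t - h k t), h, 5 + 2 * π * M 0,
    fun k => (continuous_softThreshold _).comp ((hhc (k + 1)).fun_sub (hhc k)), fun k t => ?_, fun k t => ?_,
    fun k => ?_, ?_, fun K t => ?_⟩
  · simp only [hhp _ t]
  · refine (abs_softThreshold_le (hη k).le _).trans ((abs_sub _ _).trans ?_)
    linarith [hhG (k + 1) t, hhG k t]
  · have hr : volume.real (Ioc 0 (2 * π) ∩ {t | softThreshold (η k) (h (k + 1) t - h k t) ≠ 0})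
        = μ.real {t | softThreshold (η k) (h (k + 1) t - h k t) ≠ 0} := by
      rw [hμ, measureReal_restrict_apply' measurableSet_Ioc, inter_comm]
    rw [hr]
    have hM0 := hM 0
    cases k with
    | zero =>
      have h1 : μ.real {t | softThreshold (η 0) (h (0 + 1) t - h 0 t) ≠ 0} ≤ 2 * π := by
        refine (measureReal_mono (subset_univ _)).trans (le_of_eq ?_)
        rw [hμ, measureReal_restrict_apply_univ, Real.volume_real_Ioc_of_le Real.two_pi_pos.le,
          sub_zero]
      rw [pow_zero, mul_one]
      nlinarith
    | succ k =>
      have hMk := hM k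
      have hMk1 := hM (k + 1)
      have hMk2 := hM (k + 1 + 1)
      have hsub : {t | softThreshold (η (k + 1)) (h (k + 1 + 1) t - h (k + 1) t) ≠ 0}
          ⊆ {t | η (k + 1 + 1) / 2 ≤ |p (k + 1) t - ψ t|} ∪ {t | η (k + 1) / 2 ≤ |p k t - ψ t|} := by
        intro t ht
        by_contra hcon
        simp only [mem_union, mem_ofPred_eq, not_or, not_le] at hcon
        refine ht (softThreshold_of_abs_le ?_)
        have h1 : |p (k + 1) t - p k t| ≤ |p (k + 1) t - ψ t| + |p k t - ψ t| := by
          rw [abs_sub_comm (p k t)]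
          exact abs_sub_le _ _ _
        have h2 := hanti (k + 1).le_succ
        change |p (k + 1) t - p k t| ≤ _
        linarith
      have h1 := (measureReal_mono hsub (μ := μ)).trans
        ((measureReal_union_le _ _).trans (add_le_add (hpm (k + 1)) (hpm k)))
      have h2 : M (k + 1) * ((1 / 4) ^ (k + 1) / (M (k + 1) + M (k + 1 + 1)))
          ≤ (1 / 4) ^ (k + 1) := by
        rw [mul_div_assoc', div_le_iff₀ (by positivity), mul_comm]
        gcongr
        linarith
      have h3 : M (k + 1) * ((1 / 4) ^ k / (M k + M (k + 1))) ≤ (1 / 4) ^ k := by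
        rw [mul_div_assoc', div_le_iff₀ (by positivity), mul_comm]
        gcongr
        linarith
      have h4 : (1 / 4 : ℝ) ^ k = 4 * (1 / 4) ^ (k + 1) := by rw [pow_succ]; ring
      have h5 : 0 ≤ 2 * π * M 0 * (1 / 4) ^ (k + 1) := by positivity
      refine (mul_le_mul_of_nonneg_left h1 hMk1.le).trans ?_
      rw [mul_add]
      linarith
  · filter_upwards [hpt] with θ hθ using (tendsto_add_atTop_iff_nat 1).1 hθ
  · have h1 : h K t = ∑ k ∈ Finset.range K, (h (k + 1) t - h k t) := by
      rw [Finset.sum_range_sub fun k => h k t]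
      simp [hh]
    rw [h1, ← Finset.sum_sub_distrib]
    exact (Finset.abs_sum_le_sum_abs _ _).trans
      (Finset.sum_le_sum fun k _ => abs_softThreshold_sub_le (hη k).le _)

end Telescoping

section Quotients

/-- Every bounded real function `ψ` is the argument, up to a uniformly small error, of a quotient of
boundary values of two Blaschke products. -/
lemma exists_blaschke_quotient_near_exp {ψ : ℝ → ℝ} (hψ : Measurable ψ) {G : ℝ}
    (hG : ∀ t, |ψ t| ≤ G) {ε : ℝ} (hε : 0 < ε) :
    ∃ ω₁ ω₂ : ℂ → ℂ, IsInner ω₁ ∧ IsInner ω₂ ∧ IsBlaschkeProductOn ω₁ (ball 0 1) ∧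
      IsBlaschkeProductOn ω₂ (ball 0 1) ∧
      ∀ᵐ (θ : ℝ) ∂(volume.restrict (Ioc (0:ℝ) (2 * π))), ∃ L₁ L₂ : ℂ, ‖L₁‖ = 1 ∧ ‖L₂‖ = 1 ∧
        Tendsto (fun r : ℝ => ω₁ (r * Complex.exp (θ * I))) (𝓝[<] 1) (𝓝 L₁) ∧
        Tendsto (fun r : ℝ => ω₂ (r * Complex.exp (θ * I))) (𝓝[<] 1) (𝓝 L₂) ∧
        ‖L₁ / L₂ - Complex.exp (ψ θ * I)‖ ≤ ε := by
  have hG0 : 0 ≤ G := (abs_nonneg _).trans (hG 0)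
  set η : ℕ → ℝ := fun k => ε / 4 * (1 / 2) ^ k with hη
  have hη0 : ∀ k, 0 < η k := fun k => by positivity
  have hanti : Antitone η := fun m n hmn => by
    have := pow_le_pow_of_le_one (by norm_num : (0:ℝ) ≤ 1 / 2) (by norm_num) hmn
    simp only [hη]
    gcongr
  have hηs : ∀ K, ∑ k ∈ Finset.range K, η k ≤ ε / 2 := fun K => by
    rw [← Finset.mul_sum]
    have := sum_geometric_two_le K
    nlinarith
  choose M hM0 hM using fun k => exists_finite_blaschke_quotient (G := 2 * G) (by positivity)
    (hη0 k)
  obtain ⟨g, h, C, hgc, hgp, hgG, hgM, hht, hgh⟩ := exists_continuous_series hψ hG hη0 hanti hM0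
  choose S a a' ha0 ha1 ha0' ha1' hm hm' hq using fun k => hM k (g k) (hgc k) (hgp k) (hgG k)
  obtain ⟨ω₁, β₁, hω₁, hb₁, hβ₁⟩ := exists_isInner_of_blocks ha0 ha1 fun k => (hm k).trans (hgM k)
  obtain ⟨ω₂, β₂, hω₂, hb₂, hβ₂⟩ :=
    exists_isInner_of_blocks ha0' ha1' fun k => (hm' k).trans (hgM k)
  refine ⟨ω₁, ω₂, hω₁, hω₂, hb₁, hb₂, ?_⟩
  filter_upwards [hβ₁, hβ₂, hht] with θ ⟨h1, hr1, hp1⟩ ⟨h2, hr2, hp2⟩ ht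
  refine ⟨β₁ θ, β₂ θ, h1, h2, hr1, hr2, ?_⟩
  have hβ₂0 : β₂ θ ≠ 0 := fun h0 => by simp [h0] at h2
  have hexp : Tendsto (fun K => Complex.exp (h K θ * I)) atTop (𝓝 (Complex.exp (ψ θ * I))) :=
    ((Complex.continuous_ofReal.tendsto _).comp ht |>.mul_const I).cexp
  refine le_of_tendsto ((hp1.div hp2 hβ₂0).sub hexp).norm (.of_forall fun K => ?_)
  have hnorm : ∀ (T : Finset ℕ) (b : ℕ → ℂ), (∀ n, b n ≠ 0) → (∀ n, ‖b n‖ < 1) →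
      ‖∏ n ∈ T, blaschkeFactor (b n) (Complex.exp (θ * I))‖ = 1 := fun T b hb0 hb1 => by
    rw [norm_prod]
    exact Finset.prod_eq_one fun n _ =>
      norm_blaschkeFactor_eq_one (hb0 n) (hb1 n) (Complex.norm_exp_ofReal_mul_I θ)
  have h3 : ‖(∏ k ∈ Finset.range K, (∏ n ∈ S k, blaschkeFactor (a k n) (Complex.exp (θ * I))) /
      ∏ n ∈ S k, blaschkeFactor (a' k n) (Complex.exp (θ * I)))
      - ∏ k ∈ Finset.range K, Complex.exp (g k θ * I)‖ ≤ ∑ k ∈ Finset.range K, η k := by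
    refine (norm_prod_sub_prod_le _ (fun k _ => ?_) fun k _ => ?_).trans
      (Finset.sum_le_sum fun k _ => hq k θ)
    · rw [norm_div, hnorm _ _ (ha0 k) (ha1 k), hnorm _ _ (ha0' k) (ha1' k), div_one]
    · exact (Complex.norm_exp_ofReal_mul_I _).le
  have h4 : ∏ k ∈ Finset.range K, Complex.exp (g k θ * I)
      = Complex.exp ((∑ k ∈ Finset.range K, g k θ : ℝ) * I) := by
    rw [← Complex.exp_sum, Complex.ofReal_sum, Finset.sum_mul]
  have h5 := (norm_exp_sub_exp_le (∑ k ∈ Finset.range K, g k θ) (h K θ)).trans (hgh K θ)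
  rw [h4, Finset.prod_div_distrib] at h3
  have h6 := (norm_sub_le_norm_sub_add_norm_sub _ _ _).trans (add_le_add h3 h5)
  exact h6.trans (by linarith [hηs K])

/-- A point of the closed unit disc is the midpoint of two points of the unit circle. -/
lemma exp_add_exp_eq_two_mul {z : ℂ} (hz : ‖z‖ ≤ 1) :
    Complex.exp ((arg z + Real.arccos ‖z‖ : ℝ) * I) +
      Complex.exp ((arg z - Real.arccos ‖z‖ : ℝ) * I) = 2 * z := by
  have hcos : Complex.cos (Real.arccos ‖z‖ : ℝ) = ‖z‖ := by
    rw [← Complex.ofReal_cos, Real.cos_arccos (by linarith [norm_nonneg z]) hz]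
  have h2 := Complex.two_cos (Real.arccos ‖z‖ : ℝ)
  rw [hcos] at h2
  have e1 : Complex.exp ((arg z + Real.arccos ‖z‖ : ℝ) * I)
      = Complex.exp (arg z * I) * Complex.exp ((Real.arccos ‖z‖ : ℝ) * I) := by
    rw [← Complex.exp_add]; congr 1; push_cast; ring
  have e2 : Complex.exp ((arg z - Real.arccos ‖z‖ : ℝ) * I)
      = Complex.exp (arg z * I) * Complex.exp (-(Real.arccos ‖z‖ : ℝ) * I) := by
    rw [← Complex.exp_add]; congr 1; push_cast; ring
  rw [e1, e2, ← mul_add, ← h2]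
  linear_combination 2 * Complex.norm_mul_exp_arg_mul_I z

end Quotients

/-- **Douglas–Rudin theorem (convex hull form).** Every function in the closed unit ball of
`L^∞(𝕋)` can be approximated in `L^∞` by convex combinations of quotients of (boundary values
of) inner functions, which may moreover be taken to be Blaschke products. -/
theorem douglas_rudin_convex_hull (f : ℝ → ℂ)
    (hmeas : AEStronglyMeasurable f (volume.restrict (Set.Ioc (0:ℝ) (2*π))))
    (hf : ∀ᵐ (θ : ℝ) ∂(volume.restrict (Set.Ioc (0:ℝ) (2*π))), ‖f θ‖ ≤ 1)
    (ε : ℝ) (hε : 0 < ε) :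
    ∃ (n : ℕ) (l : Fin n → ℝ) (ω₁ ω₂ : Fin n → ℂ → ℂ),
      (∀ i, 0 ≤ l i) ∧ (∑ i, l i = 1) ∧
      (∀ i, IsInner (ω₁ i) ∧ IsInner (ω₂ i) ∧
        IsBlaschkeProductOn (ω₁ i) (ball (0:ℂ) 1) ∧
        IsBlaschkeProductOn (ω₂ i) (ball (0:ℂ) 1)) ∧
      ∀ᵐ (θ : ℝ) ∂(volume.restrict (Set.Ioc (0:ℝ) (2*π))),
        ∃ L₁ L₂ : Fin n → ℂ,
          (∀ i, ‖L₁ i‖ = 1 ∧ ‖L₂ i‖ = 1 ∧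
            Tendsto (fun r : ℝ => ω₁ i ((r : ℂ) * Complex.exp ((θ : ℂ) * Complex.I)))
              (𝓝[<] (1:ℝ)) (𝓝 (L₁ i)) ∧
            Tendsto (fun r : ℝ => ω₂ i ((r : ℂ) * Complex.exp ((θ : ℂ) * Complex.I)))
              (𝓝[<] (1:ℝ)) (𝓝 (L₂ i))) ∧
          ‖(∑ i, (l i : ℂ) * (L₁ i / L₂ i)) - f θ‖ < ε := by
  set F : ℝ → ℂ := hmeas.mk f with hF
  have hFm : Measurable F := hmeas.stronglyMeasurable_mk.measurable
  have harg : Measurable fun θ => arg (F θ) := Complex.measurable_arg.comp hFm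
  have hacos : Measurable fun θ => Real.arccos ‖F θ‖ :=
    Real.continuous_arccos.measurable.comp hFm.norm
  set ψ : Fin 2 → ℝ → ℝ := ![fun θ => arg (F θ) + Real.arccos ‖F θ‖,
    fun θ => arg (F θ) - Real.arccos ‖F θ‖] with hψ
  have hψm : ∀ i, Measurable (ψ i) := by
    intro i
    fin_cases i
    exacts [harg.add hacos, harg.sub hacos]
  have hψG : ∀ i t, |ψ i t| ≤ 2 * π := by
    intro i t
    have h1 := abs_arg_le_pi (F t)
    have h2 : |Real.arccos ‖F t‖| ≤ π := by
      rw [abs_of_nonneg (Real.arccos_nonneg _)]; exact Real.arccos_le_pi _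
    fin_cases i
    · exact (abs_add_le _ _).trans (by linarith)
    · exact (abs_sub _ _).trans (by linarith)
  choose ω₁ ω₂ hω₁ hω₂ hb₁ hb₂ hL using fun i =>
    exists_blaschke_quotient_near_exp (hψm i) (hψG i) (half_pos hε)
  refine ⟨2, fun _ => 1 / 2, ω₁, ω₂, fun _ => by norm_num, by simp,
    fun i => ⟨hω₁ i, hω₂ i, hb₁ i, hb₂ i⟩, ?_⟩
  filter_upwards [ae_all_iff.2 hL, hf, hmeas.ae_eq_mk] with θ hθ hfθ heq
  choose L₁ L₂ h1 h2 hr1 hr2 hd using hθ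
  refine ⟨L₁, L₂, fun i => ⟨h1 i, h2 i, hr1 i, hr2 i⟩, ?_⟩
  have hmid : Complex.exp (ψ 0 θ * I) + Complex.exp (ψ 1 θ * I) = 2 * f θ := by
    rw [heq] at hfθ ⊢
    exact exp_add_exp_eq_two_mul hfθ
  have e : ∑ i, ((1 / 2 : ℝ) : ℂ) * (L₁ i / L₂ i) - f θ
      = 1 / 2 * (L₁ 0 / L₂ 0 - Complex.exp (ψ 0 θ * I)) +
        1 / 2 * (L₁ 1 / L₂ 1 - Complex.exp (ψ 1 θ * I)) := by
    rw [Fin.sum_univ_two]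
    push_cast
    linear_combination (1 / 2) * hmid
  rw [e]
  refine (norm_add_le _ _).trans_lt ?_
  rw [norm_mul, norm_mul]
  have hhalf : ‖(1 / 2 : ℂ)‖ = 1 / 2 := by norm_num
  rw [hhalf]
  linarith [hd 0, hd 1]
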